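/- arXiv:1411.6401 — 2 statements merged into one kernel-verified Lean document; each statement's English description precedes it below -/
import Mathlib

section
/- Let G be a finite simple graph that is 3-edge-connected and has minimum degree δ(G) ≥ 4. If the independence number of G satisfies α(G) ≤ 2, then G is Z₃-connected. -/
open Finset

/-- A graph `G` is `A`-connected: for every `b : V → A` summing to zero, there is an
antisymmetric map `f : V → V → A` that is nonzero exactly on (ordered) edges of `G`
(this encodes an orientation together with a map `E(G) → A \ {0}`) whose boundary
`∂f(v) = ∑ u, f v u` equals `b v` at every vertex. -/
def SimpleGraph.AConnected {V : Type} [Fintype V] (G : SimpleGraph V)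
    (A : Type) [AddCommGroup A] : Prop :=
  ∀ b : V → A, ∑ v, b v = 0 →
    ∃ f : V → V → A,
      (∀ u v, f u v = - f v u) ∧
      (∀ u v, G.Adj u v ↔ f u v ≠ 0) ∧
      (∀ v, ∑ u, f v u = b v)

/-- `G` is 3-edge-connected: every nonempty proper vertex subset `S` is joined to its
complement by at least 3 edges. -/
def SimpleGraph.ThreeEdgeConnected {V : Type} [Fintype V] [DecidableEq V]
    (G : SimpleGraph V) [DecidableRel G.Adj] : Prop :=
  ∀ S : Finset V, S.Nonempty → S ≠ univ →
    3 ≤ ((S ×ˢ Sᶜ).filter fun p => G.Adj p.1 p.2).card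

namespace ZThree

variable {V : Type}

/-- `f` is an antisymmetric `ZMod 3`-valued map, nonzero exactly on the edges of `E`. -/
def IsFlow (E : SimpleGraph V) (f : V → V → ZMod 3) : Prop :=
  (∀ u v, f u v = - f v u) ∧ ∀ u v, E.Adj u v ↔ f u v ≠ 0

lemma IsFlow.add {E F : SimpleGraph V} {f g : V → V → ZMod 3} (hf : IsFlow E f)
    (hg : IsFlow F g) (h : Disjoint E F) :
    IsFlow (E ⊔ F) (fun u v => f u v + g u v) := by
  refine ⟨fun u v => ?_, fun u v => ?_⟩
  · dsimp only; rw [hf.1 u v, hg.1 u v]; ring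
  · have h1 := hf.2 u v
    have h2 := hg.2 u v
    have h3 : ¬ (E.Adj u v ∧ F.Adj u v) := fun hh => by
      simpa only [SimpleGraph.bot_adj] using h.le_bot (show (E ⊓ F).Adj u v from hh)
    rw [SimpleGraph.sup_adj]
    by_cases a : f u v = 0 <;> by_cases b : g u v = 0 <;> simp_all

variable [Fintype V]

lemma exists_isFlow (E : SimpleGraph V) : ∃ f, IsFlow E f := by
  classical
  let φ := Fintype.equivFin V
  refine ⟨fun u v => if E.Adj u v then (if φ u < φ v then 1 else -1) else 0, ?_, ?_⟩
  · intro u v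
    simp only [E.adj_comm v u]
    by_cases h : E.Adj u v
    · have : φ u ≠ φ v := fun hh => h.ne (φ.injective hh)
      rcases lt_or_gt_of_ne this with h1 | h1 <;> simp [h, h1, h1.not_gt]
    · simp [h]
  · intro u v
    by_cases h : E.Adj u v <;> simp only [h, if_true, if_false, true_iff, false_iff]
    · split_ifs <;> decide
    · simp

lemma IsFlow.sum_eq_zero {E : SimpleGraph V} {f : V → V → ZMod 3} (hf : IsFlow E f) :
    ∑ x, ∑ y, f x y = 0 := by
  have h : ∑ x, ∑ y, f x y = - ∑ x, ∑ y, f x y := by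
    conv_lhs => rw [Finset.sum_comm]
    simp only [← Finset.sum_neg_distrib]
    exact Finset.sum_congr rfl fun x _ => Finset.sum_congr rfl fun y _ => hf.1 y x
  generalize ∑ x, ∑ y, f x y = s at h
  revert s; decide

variable [DecidableEq V]

/-- The indicator of `u`, with values in `ZMod 3`. -/
def ind (u x : V) : ZMod 3 := if x = u then 1 else 0

lemma sum_ind (u : V) : ∑ x, ind u x = 1 := by simp [ind]

lemma IsFlow.add_edge {E : SimpleGraph V} {u v : V} {g : V → V → ZMod 3}
    (hg : IsFlow (E.deleteEdges {s(u, v)}) g) (huv : E.Adj u v) {s : ZMod 3} (hs : s ≠ 0) :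
    ∃ f, IsFlow E f ∧ ∀ x, ∑ y, f x y = ∑ y, g x y + s * (ind u x - ind v x) := by
  refine ⟨fun x y => g x y + s * (ind u x * ind v y - ind v x * ind u y), ⟨?_, ?_⟩, ?_⟩
  · intro x y
    dsimp only; rw [hg.1 x y]; ring
  · intro x y
    have h := hg.2 x y
    have hne := huv.ne
    simp only [SimpleGraph.deleteEdges_adj, Set.mem_singleton_iff, Sym2.eq_iff] at h
    by_cases h1 : x = u ∧ y = v
    · obtain ⟨rfl, rfl⟩ := h1
      simp_all [ind]
    · by_cases h2 : x = v ∧ y = u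
      · obtain ⟨rfl, rfl⟩ := h2
        simp_all [ind, huv.symm]
      · have : ind u x * ind v y - ind v x * ind u y = 0 := by
          unfold ind; split_ifs <;> simp_all
        dsimp only
        rw [this, mul_zero, add_zero, ← h]
        simp [h1, h2]
  · intro x
    rw [Finset.sum_add_distrib, ← Finset.mul_sum, Finset.sum_sub_distrib, ← Finset.mul_sum,
      ← Finset.mul_sum, sum_ind, sum_ind, mul_one, mul_one]

/-- The boundary of the flow with value `σ i` on the `i`-th edge of `L`. -/
def listBd (L : List (V × V)) (σ : List (ZMod 3)) (x : V) : ZMod 3 :=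
  (List.zipWith (fun p s => s * (ind p.1 x - ind p.2 x)) L σ).sum

lemma exists_isFlow_list (L : List (V × V)) : ∀ E : SimpleGraph V,
    (∀ p ∈ L, E.Adj p.1 p.2) → (L.map fun p => s(p.1, p.2)).Nodup →
    ∃ c : V → ZMod 3, ∀ σ : List (ZMod 3), σ.length = L.length → (∀ s ∈ σ, s ≠ 0) →
      ∃ f, IsFlow E f ∧ ∀ x, ∑ y, f x y = c x + listBd L σ x := by
  induction L with
  | nil =>
    intro E _ _
    obtain ⟨f, hf⟩ := exists_isFlow E
    exact ⟨fun x => ∑ y, f x y, fun σ _ _ => ⟨f, hf, fun x => by simp [listBd]⟩⟩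
  | cons p L ih =>
    intro E hE hL
    rw [List.map_cons, List.nodup_cons] at hL
    obtain ⟨c, hc⟩ := ih (E.deleteEdges {s(p.1, p.2)}) (fun q hq => by
      rw [SimpleGraph.deleteEdges_adj]
      refine ⟨hE q (List.mem_cons_of_mem _ hq), fun h => hL.1 ?_⟩
      rw [← Set.mem_singleton_iff.1 h]
      exact List.mem_map_of_mem (f := fun p : V × V => s(p.1, p.2)) hq) hL.2
    refine ⟨c, fun σ hσ h0 => ?_⟩
    cases σ with
    | nil => simp at hσ
    | cons s σ =>
      obtain ⟨g, hg, hgc⟩ := hc σ (by simpa using hσ) fun s hs => h0 s (List.mem_cons_of_mem _ hs)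
      obtain ⟨f, hf, hfc⟩ := hg.add_edge (hE p List.mem_cons_self) (h0 s List.mem_cons_self)
      refine ⟨f, hf, fun x => ?_⟩
      rw [hfc, hgc]
      simp only [listBd, List.zipWith_cons_cons, List.sum_cons]
      ring

/-- Every zero-sum map supported on `U` is the boundary of a flow on `E`. -/
def Spans (E : SimpleGraph V) (U : Finset V) : Prop :=
  ∀ b : V → ZMod 3, (∀ x ∉ U, b x = 0) → ∑ x, b x = 0 →
    ∃ f, IsFlow E f ∧ ∀ x, ∑ y, f x y = b x

lemma Spans.extend {E F : SimpleGraph V} {U R : Finset V} (hE : Spans E U)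
    (hEF : Disjoint E F) (hF : ∀ x y, F.Adj x y → x ∈ U ∪ R)
    (h : ∀ b : V → ZMod 3, ∃ f, IsFlow F f ∧ ∀ x ∈ R, ∑ y, f x y = b x) :
    Spans (E ⊔ F) (U ∪ R) := by
  intro b hb hb0
  obtain ⟨g, hg, hgR⟩ := h b
  obtain ⟨f, hf, hfb⟩ := hE (fun x => b x - ∑ y, g x y) (fun x hx => by
      by_cases hxR : x ∈ R
      · rw [hgR x hxR, sub_self]
      · have hx' : x ∉ U ∪ R := by simp [hx, hxR]
        rw [hb x hx', Finset.sum_eq_zero, sub_zero]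
        intro y _
        by_contra hne
        exact hx' (hF x y ((hg.2 x y).2 hne)))
    (by rw [Finset.sum_sub_distrib, hb0, hg.sum_eq_zero, sub_zero])
  refine ⟨_, hf.add hg hEF, fun x => ?_⟩
  rw [Finset.sum_add_distrib, hfb, sub_add_cancel]

/-- The edges of `H` with both ends in `U`. -/
def inner (H : SimpleGraph V) (U : Finset V) : SimpleGraph V where
  Adj x y := H.Adj x y ∧ x ∈ U ∧ y ∈ U
  symm := ⟨fun _ _ h => ⟨h.1.symm, h.2.2, h.2.1⟩⟩
  loopless := ⟨fun _ h => h.1.ne rfl⟩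

/-- The edges of `H` inside `U`, together with those of `L`, span `U`. -/
def Good (H L : SimpleGraph V) (U : Finset V) : Prop :=
  Spans (inner H U ⊔ L) U

lemma Good.extend {H L : SimpleGraph V} {U R : Finset V} (hU : Good H L U) (hHL : Disjoint H L)
    (e : List (V × V)) (he : ∀ p ∈ e, H.Adj p.1 p.2 ∧ p.1 ∈ R ∧ p.2 ∈ U ∪ R)
    (hUR : Disjoint U R) (hnd : (e.map fun p => s(p.1, p.2)).Nodup)
    (h : ∀ t : V → ZMod 3, ∃ σ : List (ZMod 3), σ.length = e.length ∧ (∀ s ∈ σ, s ≠ 0) ∧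
      ∀ x ∈ R, listBd e σ x = t x) :
    Good H L (U ∪ R) := by
  have hle : inner H U ≤ inner H (U ∪ R) := fun x y hxy =>
    ⟨hxy.1, mem_union_left _ hxy.2.1, mem_union_left _ hxy.2.2⟩
  have key : Spans ((inner H U ⊔ L) ⊔ (inner H (U ∪ R) \ inner H U)) (U ∪ R) := by
    refine Spans.extend hU ?_ (fun x y hxy => hxy.1.2.1) fun b => ?_
    · refine Disjoint.sup_left disjoint_sdiff_self_right ?_
      exact (hHL.mono_left fun x y hxy => hxy.1.1).symm
    · obtain ⟨c, hc⟩ := exists_isFlow_list e (inner H (U ∪ R) \ inner H U) (fun p hp => by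
        obtain ⟨h1, h2, h3⟩ := he p hp
        exact ⟨⟨h1, mem_union_right _ h2, h3⟩,
          fun h4 => Finset.disjoint_left.1 hUR h4.2.1 h2⟩) hnd
      obtain ⟨σ, h1, h2, h3⟩ := h fun x => b x - c x
      obtain ⟨f, hf, hfc⟩ := hc σ h1 h2
      refine ⟨f, hf, fun x hx => ?_⟩
      rw [hfc, h3 x hx]; ring
  have heq : (inner H U ⊔ L) ⊔ (inner H (U ∪ R) \ inner H U) = inner H (U ∪ R) ⊔ L := by
    rw [sup_right_comm, sup_sdiff_cancel_right hle]
  rw [Good, ← heq]; exact key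

lemma Good.aconnected {G H L : SimpleGraph V} (h : Good H L univ) (hHL : H ⊔ L = G) :
    G.AConnected (ZMod 3) := by
  intro b hb
  obtain ⟨f, hf, hfb⟩ := h b (by simp) hb
  have : inner H univ ⊔ L = G := by
    rw [← hHL]; congr 1; ext x y; simp [inner]
  rw [this] at hf
  exact ⟨f, hf.1, hf.2, hfb⟩

lemma good_singleton (H : SimpleGraph V) (p : V) : Good H ⊥ {p} := by
  intro b hb hb0
  have hb' : ∀ x, b x = 0 := by
    intro x
    by_cases hx : x = p
    · subst hx
      rwa [Finset.sum_eq_single x (fun y _ hy => hb y (by simpa using hy)) (by simp)] at hb0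
    · exact hb x (by simpa using hx)
  refine ⟨fun _ _ => 0, ⟨by simp, fun x y => ?_⟩, by simp [hb']⟩
  have : ¬ (H.Adj x y ∧ x = p ∧ y = p) := by
    rintro ⟨h, rfl, rfl⟩; exact h.ne rfl
  simpa [inner] using this

lemma exists_signs_pair (t : ZMod 3) : ∃ s₁ ≠ 0, ∃ s₂ ≠ 0, s₁ + s₂ = t := by
  revert t; decide

set_option synthInstance.maxHeartbeats 200000 in
set_option synthInstance.maxSize 2000 in
lemma exists_signs_K4 : ∀ a b c d : ZMod 3, a + b + c + d = 0 →
    ¬ (a = 0 ∧ b = 0 ∧ c = 0 ∧ d = 0) →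
    ∃ s₁ ≠ 0, ∃ s₂ ≠ 0, ∃ s₃ ≠ 0, s₁ + s₂ + s₃ = a ∧ ∃ s₄ ≠ 0, ∃ s₅ ≠ 0,
      -s₁ + s₄ + s₅ = b ∧ ∃ s₆ ≠ 0, -s₂ - s₄ + s₆ = c ∧ -s₃ - s₅ - s₆ = d := by
  decide +kernel

/-- If every zero-sum target except `0` is attainable on a `K₄`, then three further edges to
the outside make every target attainable. -/
lemma exists_signs_three : ∀ a b c d : ZMod 3, ∃ t₁ ≠ 0, ∃ t₂ ≠ 0, ∃ t₃ ≠ 0,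
    a - t₁ + (b - t₂) + (c - t₃) + d = 0 ∧
    ¬ (a - t₁ = 0 ∧ b - t₂ = 0 ∧ c - t₃ = 0 ∧ d = 0) := by
  decide +kernel

lemma exists_signs_five : ∀ a b c d e : ZMod 3,
    ∃ t₁ ≠ 0, ∃ t₂ ≠ 0, ∃ t₃ ≠ 0, t₁ + t₂ + t₃ = e ∧ ∃ t₄ ≠ 0, ∃ t₅ ≠ 0,
      a + t₁ + (b + t₂) + (c - t₄) + (d - t₅) = 0 ∧
      ¬ (a + t₁ = 0 ∧ b + t₂ = 0 ∧ c - t₄ = 0 ∧ d - t₅ = 0) := by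
  decide +kernel

lemma exists_signs_six : ∀ a b c d e : ZMod 3,
    ∃ x ≠ 0, ∃ y ≠ 0, ∃ t₁ ≠ 0, ∃ t₂ ≠ 0, ∃ t₃ ≠ 0, ∃ t₄ ≠ 0, t₁ + t₂ + t₃ + t₄ = e ∧
      a - x + t₁ + (b - y + t₂) + (c + t₃) + (d + t₄) = 0 ∧
      ¬ (a - x + t₁ = 0 ∧ b - y + t₂ = 0 ∧ c + t₃ = 0 ∧ d + t₄ = 0) := by
  decide +kernel

section Extensions

variable {H L : SimpleGraph V} {U : Finset V}

lemma Good.insert_two (hU : Good H L U) (hHL : Disjoint H L) {y u₁ u₂ : V} (hy : y ∉ U)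
    (h₁ : u₁ ∈ U) (h₂ : u₂ ∈ U) (h₁₂ : u₁ ≠ u₂) (a₁ : H.Adj y u₁) (a₂ : H.Adj y u₂) :
    Good H L (U ∪ {y}) := by
  refine hU.extend hHL [(y, u₁), (y, u₂)] ?_ (by simpa using hy) ?_ fun t => ?_
  · simp [*]
  · simp [h₁₂, a₂.ne, a₁.ne']
  · obtain ⟨s₁, n₁, s₂, n₂, h⟩ := exists_signs_pair (t y)
    refine ⟨[s₁, s₂], rfl, by simp [n₁, n₂], fun x hx => ?_⟩
    rw [mem_singleton] at hx
    subst hx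
    simp [listBd, ind, a₁.ne, a₂.ne, h]

lemma Good.union_K4 (hU : Good H L U) (hHL : Disjoint H L) {r₁ r₂ r₃ r₄ u₁ u₂ u₃ : V}
    (h₁ : r₁ ∉ U) (h₂ : r₂ ∉ U) (h₃ : r₃ ∉ U) (h₄ : r₄ ∉ U)
    (a₁₂ : H.Adj r₁ r₂) (a₁₃ : H.Adj r₁ r₃) (a₁₄ : H.Adj r₁ r₄)
    (a₂₃ : H.Adj r₂ r₃) (a₂₄ : H.Adj r₂ r₄) (a₃₄ : H.Adj r₃ r₄)
    (m₁ : u₁ ∈ U) (m₂ : u₂ ∈ U) (m₃ : u₃ ∈ U)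
    (b₁ : H.Adj r₁ u₁) (b₂ : H.Adj r₂ u₂) (b₃ : H.Adj r₃ u₃) :
    Good H L (U ∪ {r₁, r₂, r₃, r₄}) := by
  have ne : ∀ r ∉ U, ∀ u ∈ U, r ≠ u ∧ u ≠ r := fun r hr u hu =>
    ⟨fun h => hr (h ▸ hu), fun h => hr (h ▸ hu)⟩
  refine hU.extend hHL [(r₁, u₁), (r₂, u₂), (r₃, u₃), (r₁, r₂), (r₁, r₃), (r₁, r₄), (r₂, r₃),
    (r₂, r₄), (r₃, r₄)] ?_ (by simp [*]) ?_ fun t => ?_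
  · simp [*]
  · simp [ne _ h₁ _ m₁, ne _ h₁ _ m₂, ne _ h₁ _ m₃, ne _ h₂ _ m₁, ne _ h₂ _ m₂, ne _ h₂ _ m₃,
      ne _ h₃ _ m₁, ne _ h₃ _ m₂, ne _ h₃ _ m₃, ne _ h₄ _ m₁, ne _ h₄ _ m₂, ne _ h₄ _ m₃,
      a₁₂.ne, a₁₃.ne, a₁₄.ne, a₂₃.ne, a₂₄.ne, a₃₄.ne,
      a₁₂.ne', a₁₃.ne', a₂₃.ne', a₂₄.ne', a₃₄.ne']
  · obtain ⟨t₁, n₁, t₂, n₂, t₃, n₃, h, h'⟩ := exists_signs_three (t r₁) (t r₂) (t r₃) (t r₄)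
    obtain ⟨s₁, o₁, s₂, o₂, s₃, o₃, e₁, s₄, o₄, s₅, o₅, e₂, s₆, o₆, e₃, e₄⟩ :=
      exists_signs_K4 _ _ _ _ h h'
    refine ⟨[t₁, t₂, t₃, s₁, s₂, s₃, s₄, s₅, s₆], rfl, by simp [*], fun x hx => ?_⟩
    simp only [mem_insert, mem_singleton] at hx
    rcases hx with rfl | rfl | rfl | rfl <;>
    · simp [listBd, ind, ne _ h₁ _ m₁, ne _ h₁ _ m₂, ne _ h₁ _ m₃, ne _ h₂ _ m₁, ne _ h₂ _ m₂,
        ne _ h₂ _ m₃, ne _ h₃ _ m₁, ne _ h₃ _ m₂, ne _ h₃ _ m₃, ne _ h₄ _ m₁, ne _ h₄ _ m₂,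
        ne _ h₄ _ m₃, a₁₂.ne, a₁₃.ne, a₁₄.ne, a₂₃.ne, a₂₄.ne, a₃₄.ne,
        a₁₂.ne', a₁₃.ne', a₁₄.ne', a₂₃.ne', a₂₄.ne', a₃₄.ne']
      first | linear_combination e₁ | linear_combination e₂ | linear_combination e₃ |
        linear_combination e₄

lemma Good.union_K4_vertex (hU : Good H L U) (hHL : Disjoint H L) {r₁ r₂ r₃ r₄ a d u₃ u₄ : V}
    (h₁ : r₁ ∉ U) (h₂ : r₂ ∉ U) (h₃ : r₃ ∉ U) (h₄ : r₄ ∉ U) (ha : a ∉ U)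
    (a₁₂ : H.Adj r₁ r₂) (a₁₃ : H.Adj r₁ r₃) (a₁₄ : H.Adj r₁ r₄)
    (a₂₃ : H.Adj r₂ r₃) (a₂₄ : H.Adj r₂ r₄) (a₃₄ : H.Adj r₃ r₄)
    (c₁ : H.Adj a r₁) (c₂ : H.Adj a r₂) (d₃ : a ≠ r₃) (d₄ : a ≠ r₄)
    (hd : d ∈ U) (m₃ : u₃ ∈ U) (m₄ : u₄ ∈ U)
    (ad : H.Adj a d) (b₃ : H.Adj r₃ u₃) (b₄ : H.Adj r₄ u₄) :
    Good H L (U ∪ {r₁, r₂, r₃, r₄, a}) := by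
  have ne : ∀ r ∉ U, ∀ u ∈ U, r ≠ u ∧ u ≠ r := fun r hr u hu =>
    ⟨fun h => hr (h ▸ hu), fun h => hr (h ▸ hu)⟩
  refine hU.extend hHL [(a, r₁), (a, r₂), (a, d), (r₃, u₃), (r₄, u₄), (r₁, r₂), (r₁, r₃),
    (r₁, r₄), (r₂, r₃), (r₂, r₄), (r₃, r₄)] ?_ (by simp [*]) ?_ fun t => ?_
  · simp [*]
  · simp [ne _ h₁ _ hd, ne _ h₁ _ m₃, ne _ h₁ _ m₄, ne _ h₂ _ hd, ne _ h₂ _ m₃, ne _ h₂ _ m₄,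
      ne _ h₃ _ hd, ne _ h₃ _ m₃, ne _ h₃ _ m₄, ne _ h₄ _ hd, ne _ h₄ _ m₃, ne _ h₄ _ m₄,
      ne _ ha _ hd, ne _ ha _ m₃, ne _ ha _ m₄, c₁.ne, c₂.ne, c₁.ne', c₂.ne', d₃, d₄,
      a₁₂.ne, a₁₃.ne, a₁₄.ne, a₂₃.ne, a₂₄.ne, a₃₄.ne,
      a₁₂.ne', a₁₃.ne', a₁₄.ne', a₂₃.ne', a₂₄.ne', a₃₄.ne']
  · obtain ⟨t₁, n₁, t₂, n₂, t₃, n₃, e₀, t₄, n₄, t₅, n₅, h, h'⟩ :=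
      exists_signs_five (t r₁) (t r₂) (t r₃) (t r₄) (t a)
    obtain ⟨s₁, o₁, s₂, o₂, s₃, o₃, e₁, s₄, o₄, s₅, o₅, e₂, s₆, o₆, e₃, e₄⟩ :=
      exists_signs_K4 _ _ _ _ h h'
    refine ⟨[t₁, t₂, t₃, t₄, t₅, s₁, s₂, s₃, s₄, s₅, s₆], rfl, by simp [*], fun x hx => ?_⟩
    simp only [mem_insert, mem_singleton] at hx
    rcases hx with rfl | rfl | rfl | rfl | rfl <;>
    · simp [listBd, ind, ne _ h₁ _ hd, ne _ h₁ _ m₃, ne _ h₁ _ m₄, ne _ h₂ _ hd, ne _ h₂ _ m₃,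
        ne _ h₂ _ m₄, ne _ h₃ _ hd, ne _ h₃ _ m₃, ne _ h₃ _ m₄, ne _ h₄ _ hd, ne _ h₄ _ m₃,
        ne _ h₄ _ m₄, ne _ ha _ hd, ne _ ha _ m₃, ne _ ha _ m₄, c₁.ne, c₂.ne, c₁.ne', c₂.ne', d₃,
        d₄, d₃.symm, d₄.symm, a₁₂.ne, a₁₃.ne, a₁₄.ne, a₂₃.ne, a₂₄.ne, a₃₄.ne,
        a₁₂.ne', a₁₃.ne', a₁₄.ne', a₂₃.ne', a₂₄.ne', a₃₄.ne']
      first | linear_combination e₁ | linear_combination e₂ | linear_combination e₃ |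
        linear_combination e₄ | linear_combination e₀

lemma Good.union_K5 (hU : Good H L U) (hHL : Disjoint H L) {r₁ r₂ r₃ r₄ a u₁ u₂ : V}
    (h₁ : r₁ ∉ U) (h₂ : r₂ ∉ U) (h₃ : r₃ ∉ U) (h₄ : r₄ ∉ U) (ha : a ∉ U)
    (a₁₂ : H.Adj r₁ r₂) (a₁₃ : H.Adj r₁ r₃) (a₁₄ : H.Adj r₁ r₄)
    (a₂₃ : H.Adj r₂ r₃) (a₂₄ : H.Adj r₂ r₄) (a₃₄ : H.Adj r₃ r₄)
    (c₁ : H.Adj a r₁) (c₂ : H.Adj a r₂) (c₃ : H.Adj a r₃) (c₄ : H.Adj a r₄)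
    (m₁ : u₁ ∈ U) (m₂ : u₂ ∈ U) (b₁ : H.Adj r₁ u₁) (b₂ : H.Adj r₂ u₂) :
    Good H L (U ∪ {r₁, r₂, r₃, r₄, a}) := by
  have ne : ∀ r ∉ U, ∀ u ∈ U, r ≠ u ∧ u ≠ r := fun r hr u hu =>
    ⟨fun h => hr (h ▸ hu), fun h => hr (h ▸ hu)⟩
  refine hU.extend hHL [(r₁, u₁), (r₂, u₂), (a, r₁), (a, r₂), (a, r₃), (a, r₄), (r₁, r₂),
    (r₁, r₃), (r₁, r₄), (r₂, r₃), (r₂, r₄), (r₃, r₄)] ?_ (by simp [*]) ?_ fun t => ?_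
  · simp [*]
  · simp [ne _ h₁ _ m₁, ne _ h₁ _ m₂, ne _ h₂ _ m₁, ne _ h₂ _ m₂, ne _ h₃ _ m₁, ne _ h₃ _ m₂,
      ne _ h₄ _ m₁, ne _ h₄ _ m₂, ne _ ha _ m₁, ne _ ha _ m₂,
      c₁.ne, c₂.ne, c₃.ne, c₄.ne, c₁.ne', c₂.ne', c₃.ne',
      a₁₂.ne, a₁₃.ne, a₁₄.ne, a₂₃.ne, a₂₄.ne, a₃₄.ne,
      a₁₂.ne', a₁₃.ne', a₁₄.ne', a₂₃.ne', a₂₄.ne', a₃₄.ne']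
  · obtain ⟨x, n₁, y, n₂, t₁, n₃, t₂, n₄, t₃, n₅, t₄, n₆, e₀, h, h'⟩ :=
      exists_signs_six (t r₁) (t r₂) (t r₃) (t r₄) (t a)
    obtain ⟨s₁, o₁, s₂, o₂, s₃, o₃, e₁, s₄, o₄, s₅, o₅, e₂, s₆, o₆, e₃, e₄⟩ :=
      exists_signs_K4 _ _ _ _ h h'
    refine ⟨[x, y, t₁, t₂, t₃, t₄, s₁, s₂, s₃, s₄, s₅, s₆], rfl, by simp [*], fun x hx => ?_⟩
    simp only [mem_insert, mem_singleton] at hx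
    rcases hx with rfl | rfl | rfl | rfl | rfl <;>
    · simp [listBd, ind, ne _ h₁ _ m₁, ne _ h₁ _ m₂, ne _ h₂ _ m₁, ne _ h₂ _ m₂, ne _ h₃ _ m₁,
        ne _ h₃ _ m₂, ne _ h₄ _ m₁, ne _ h₄ _ m₂, ne _ ha _ m₁, ne _ ha _ m₂,
        c₁.ne, c₂.ne, c₃.ne, c₄.ne, c₁.ne', c₂.ne', c₃.ne', c₄.ne',
        a₁₂.ne, a₁₃.ne, a₁₄.ne, a₂₃.ne, a₂₄.ne, a₃₄.ne,
        a₁₂.ne', a₁₃.ne', a₁₄.ne', a₂₃.ne', a₂₄.ne', a₃₄.ne']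
      first | linear_combination e₁ | linear_combination e₂ | linear_combination e₃ |
        linear_combination e₄ | linear_combination e₀

end Extensions

/-- Splitting the edges `ab` and `ac` of a triangle off at `a` doubles the edge `bc`. -/
lemma good_pair {G L : SimpleGraph V} {a b c : V} (hab : G.Adj a b) (hac : G.Adj a c)
    (hbc : G.Adj b c)
    (hL : ∀ x y, L.Adj x y ↔ s(x, y) = s(a, b) ∨ s(x, y) = s(a, c)) :
    Good (G \ L) L {b, c} := by
  have n₁ := hab.ne
  have n₂ := hac.ne
  have n₃ := hbc.ne
  intro t ht ht0
  have hsum : t b + t c = 0 := by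
    rw [← ht0, ← Finset.sum_pair n₃]
    exact Finset.sum_subset (subset_univ _) fun x _ hx => ht x hx
  obtain ⟨s₁, h₁, s₂, h₂, h⟩ := exists_signs_pair (t b)
  set E := inner (G \ L) {b, c} ⊔ L with hE
  have hEa : ∀ x y, E.Adj x y ↔ s(x, y) = s(a, b) ∨ s(x, y) = s(a, c) ∨ s(x, y) = s(b, c) := by
    intro x y
    rw [hE, SimpleGraph.sup_adj, hL]
    simp only [inner, SimpleGraph.sdiff_adj, hL, mem_insert, mem_singleton, Sym2.eq_iff]
    constructor
    · rintro (⟨⟨h1, h2⟩, rfl | rfl, rfl | rfl⟩ | h)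
      · exact (h1.ne rfl).elim
      · simp
      · simp
      · exact (h1.ne rfl).elim
      · tauto
    · rintro (h | h | h)
      · tauto
      · tauto
      · left
        rcases h with ⟨rfl, rfl⟩ | ⟨rfl, rfl⟩
        · exact ⟨⟨hbc, by grind⟩, by simp⟩
        · exact ⟨⟨hbc.symm, by grind⟩, by simp⟩
  have h0 : IsFlow (((E.deleteEdges {s(a, b)}).deleteEdges {s(a, c)}).deleteEdges {s(b, c)})
      (fun _ _ => 0) := by
    refine ⟨by simp, fun x y => ?_⟩
    simp only [SimpleGraph.deleteEdges_adj, hEa, Set.mem_singleton_iff]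
    tauto
  obtain ⟨f₁, hf₁, e₁⟩ := h0.add_edge (by
    simp only [SimpleGraph.deleteEdges_adj, hEa, Set.mem_singleton_iff, Sym2.eq_iff]; grind) h₁
  obtain ⟨f₂, hf₂, e₂⟩ := hf₁.add_edge (by
    simp only [SimpleGraph.deleteEdges_adj, hEa, Set.mem_singleton_iff, Sym2.eq_iff]; grind) h₂
  obtain ⟨f₃, hf₃, e₃⟩ := hf₂.add_edge (by
    simp only [hEa, Sym2.eq_iff]; grind) (neg_ne_zero.2 h₂)
  refine ⟨f₃, hf₃, fun x => ?_⟩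
  rw [e₃, e₂, e₁]
  by_cases xb : x = b
  · subst xb
    simp [ind, n₁.symm, n₃, h]
  by_cases xc : x = c
  · subst xc
    simp [ind, n₂.symm, n₃.symm]
    linear_combination -h - hsum
  rw [ht x (by simp [xb, xc])]
  simp only [ind, xb, xc, if_false, Finset.sum_const_zero]
  split_ifs <;> ring

lemma Good.exists_maximal {H L : SimpleGraph V} {U₀ : Finset V} (h : Good H L U₀) :
    ∃ U, U₀ ⊆ U ∧ Good H L U ∧ ∀ W, Good H L W → U ⊆ W → W ⊆ U := by
  obtain ⟨U, hU, hm⟩ := (Set.toFinite {U | Good H L U}).exists_le_maximal h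
  exact ⟨U, hU, hm.1, fun W hW hUW => hm.2 hW hUW⟩

lemma exists_four {α : Type} [DecidableEq α] {S : Finset α} (h : 4 ≤ S.card) :
    ∃ a ∈ S, ∃ b ∈ S, ∃ c ∈ S, ∃ d ∈ S, a ≠ b ∧ a ≠ c ∧ a ≠ d ∧ b ≠ c ∧ b ≠ d ∧ c ≠ d := by
  obtain ⟨a, ha⟩ := Finset.card_pos.1 (by omega : 0 < S.card)
  obtain ⟨b, hb, c, hc, d, hd, h1, h2, h3⟩ := Finset.two_lt_card.1
    (by rw [Finset.card_erase_of_mem ha]; omega : 2 < (S.erase a).card)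
  simp only [mem_erase] at hb hc hd
  exact ⟨a, ha, b, hb.2, c, hc.2, d, hd.2, hb.1.symm, hc.1.symm, hd.1.symm, h1, h2, h3⟩

section Graph

variable {G : SimpleGraph V}

lemma adj_of_few
    (halpha : ∀ a b c : V, a ≠ b → b ≠ c → a ≠ c → G.Adj a b ∨ G.Adj b c ∨ G.Adj a c)
    {U : Finset V} (hU : 3 ≤ U.card) {u v : V} (huU : u ∉ U) (hvU : v ∉ U) (huv : u ≠ v)
    (hu : ∃ w, ∀ x ∈ U, G.Adj u x → x = w) (hv : ∃ w, ∀ x ∈ U, G.Adj v x → x = w) :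
    G.Adj u v := by
  by_contra hn
  obtain ⟨x, hx, y, hy, z, hz, h1, h2, h3⟩ := Finset.two_lt_card.1 hU
  obtain ⟨w, hw⟩ := hu
  obtain ⟨w', hw'⟩ := hv
  have key : ∀ x ∈ U, x = w ∨ x = w' := fun x hx => by
    rcases halpha u v x huv (fun h => hvU (h ▸ hx)) (fun h => huU (h ▸ hx)) with h | h | h
    · exact (hn h).elim
    · exact Or.inr (hw' x hx h)
    · exact Or.inl (hw x hx h)
  have := key x hx
  have := key y hy
  have := key z hz
  grind

variable [DecidableRel G.Adj]

lemma four_le_card (hdeg : ∀ v : V, 4 ≤ G.degree v) {y : V} {T : Finset V}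
    (h : ∀ x, G.Adj y x → x ∈ T) : 4 ≤ T.card :=
  (hdeg y).trans (Finset.card_le_card fun x hx => h x (by simpa using hx))

lemma Good.aconnected_of_three_le {H L : SimpleGraph V} {U₀ : Finset V}
    (h3ec : G.ThreeEdgeConnected) (hdeg : ∀ v : V, 4 ≤ G.degree v)
    (halpha : ∀ a b c : V, a ≠ b → b ≠ c → a ≠ c → G.Adj a b ∨ G.Adj b c ∨ G.Adj a c)
    (hHL : Disjoint H L) (hG : H ⊔ L = G) (hgood : Good H L U₀) (hU₀ : 3 ≤ U₀.card)
    (hL : ∀ x y, L.Adj x y → x ∈ U₀) : G.AConnected (ZMod 3) := by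
  obtain ⟨U, hsub, hU, hmax⟩ := hgood.exists_maximal
  by_cases huniv : U = univ
  · subst huniv
    exact hU.aconnected hG
  exfalso
  have hcard : 3 ≤ U.card := hU₀.trans (card_le_card hsub)
  have hH : ∀ x y, x ∉ U → G.Adj x y → H.Adj x y := fun x y hx hxy => by
    rw [← hG, SimpleGraph.sup_adj] at hxy
    exact hxy.resolve_right fun h => hx (hsub (hL x y h))
  have hclosed : ∀ y ∉ U, ∀ u₁ ∈ U, ∀ u₂ ∈ U, G.Adj y u₁ → G.Adj y u₂ → u₁ = u₂ := by
    intro y hy u₁ h₁ u₂ h₂ a₁ a₂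
    by_contra hne
    exact hy (hmax _ (hU.insert_two hHL hy h₁ h₂ hne (hH _ _ hy a₁) (hH _ _ hy a₂))
      subset_union_left (by simp))
  have hfew : ∀ y ∉ U, ∃ w, ∀ x ∈ U, G.Adj y x → x = w := fun y hy => by
    by_cases h : ∃ w ∈ U, G.Adj y w
    · obtain ⟨w, hw, hyw⟩ := h
      exact ⟨w, fun x hx hyx => hclosed y hy x hx w hw hyx hyw⟩
    · exact ⟨y, fun x hx hyx => (h ⟨x, hx, hyx⟩).elim⟩
  have hclique : ∀ y ∉ U, ∀ z ∉ U, y ≠ z → H.Adj y z := fun y hy z hz hyz =>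
    hH _ _ hy (adj_of_few halpha hcard hy hz hyz (hfew y hy) (hfew z hz))
  obtain ⟨y₀, hy₀⟩ : ∃ y, y ∉ U := by
    by_contra h; push Not at h; exact huniv (eq_univ_iff_forall.2 h)
  have h4 : 4 ≤ Uᶜ.card := by
    obtain ⟨w, hw⟩ := hfew y₀ hy₀
    have h := four_le_card hdeg (y := y₀) (T := insert w (Uᶜ.erase y₀)) fun x hx => by
      by_cases hxU : x ∈ U
      · simp [hw x hxU hx]
      · simp [hxU, hx.ne']
    have := (card_insert_le w (Uᶜ.erase y₀))
    rw [card_erase_of_mem (by simpa using hy₀)] at this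
    omega
  by_cases h5 : Uᶜ.card = 4
  · have hnbr : ∀ y ∉ U, ∃ u ∈ U, H.Adj y u := fun y hy => by
      by_contra h
      have h := four_le_card hdeg (y := y) (T := Uᶜ.erase y) fun x hx => by
        by_cases hxU : x ∈ U
        · exact (h ⟨x, hxU, hH _ _ hy hx⟩).elim
        · simp [hxU, hx.ne']
      rw [card_erase_of_mem (by simpa using hy)] at h
      omega
    obtain ⟨r₁, h₁, r₂, h₂, r₃, h₃, r₄, h₄, n₁₂, n₁₃, n₁₄, n₂₃, n₂₄, n₃₄⟩ := exists_four h4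
    rw [mem_compl] at h₁ h₂ h₃ h₄
    obtain ⟨u₁, m₁, b₁⟩ := hnbr r₁ h₁
    obtain ⟨u₂, m₂, b₂⟩ := hnbr r₂ h₂
    obtain ⟨u₃, m₃, b₃⟩ := hnbr r₃ h₃
    exact h₁ (hmax _ (hU.union_K4 hHL h₁ h₂ h₃ h₄ (hclique _ h₁ _ h₂ n₁₂)
      (hclique _ h₁ _ h₃ n₁₃) (hclique _ h₁ _ h₄ n₁₄) (hclique _ h₂ _ h₃ n₂₃)
      (hclique _ h₂ _ h₄ n₂₄) (hclique _ h₃ _ h₄ n₃₄) m₁ m₂ m₃ b₁ b₂ b₃)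
      subset_union_left (by simp))
  · have hcut := h3ec U (card_pos.1 (by omega)) huniv
    obtain ⟨⟨u₁, r₁⟩, hp, ⟨u₂, r₂⟩, hq, hpq⟩ :=
      Finset.one_lt_card.1 (lt_of_lt_of_le (by norm_num : 1 < 3) hcut)
    simp only [mem_filter, mem_product, mem_compl] at hp hq
    obtain ⟨⟨m₁, h₁⟩, b₁⟩ := hp
    obtain ⟨⟨m₂, h₂⟩, b₂⟩ := hq
    have n₁₂ : r₁ ≠ r₂ := by
      rintro rfl
      exact hpq (by rw [hclosed r₁ h₁ u₁ m₁ u₂ m₂ b₁.symm b₂.symm])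
    obtain ⟨r₃, h₃, r₄, h₄, r₅, h₅, n₃₄, n₃₅, n₄₅⟩ := Finset.two_lt_card.1
      (show 2 < ((Uᶜ.erase r₁).erase r₂).card by
        rw [card_erase_of_mem (by simp [h₂, n₁₂.symm]), card_erase_of_mem (by simp [h₁])]
        omega)
    simp only [mem_erase, mem_compl] at h₃ h₄ h₅
    obtain ⟨n₂₃, n₁₃, h₃⟩ := h₃
    obtain ⟨n₂₄, n₁₄, h₄⟩ := h₄
    obtain ⟨n₂₅, n₁₅, h₅⟩ := h₅
    exact h₁ (hmax _ (hU.union_K5 hHL h₁ h₂ h₃ h₄ h₅ (hclique _ h₁ _ h₂ n₁₂)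
      (hclique _ h₁ _ h₃ n₁₃.symm) (hclique _ h₁ _ h₄ n₁₄.symm) (hclique _ h₂ _ h₃ n₂₃.symm)
      (hclique _ h₂ _ h₄ n₂₄.symm) (hclique _ h₃ _ h₄ n₃₄)
      (hclique _ h₅ _ h₁ n₁₅) (hclique _ h₅ _ h₂ n₂₅) (hclique _ h₅ _ h₃ n₃₅.symm)
      (hclique _ h₅ _ h₄ n₄₅.symm) m₁ m₂ (hH _ _ h₁ b₁.symm) (hH _ _ h₂ b₂.symm))
      subset_union_left (by simp))

lemma aconnected_of_K4_of_three_adj (h3ec : G.ThreeEdgeConnected)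
    (hdeg : ∀ v : V, 4 ≤ G.degree v)
    (halpha : ∀ a b c : V, a ≠ b → b ≠ c → a ≠ c → G.Adj a b ∨ G.Adj b c ∨ G.Adj a c)
    {r₁ r₂ r₃ r₄ p : V} (a₁₂ : G.Adj r₁ r₂) (a₁₃ : G.Adj r₁ r₃) (a₁₄ : G.Adj r₁ r₄)
    (a₂₃ : G.Adj r₂ r₃) (a₂₄ : G.Adj r₂ r₄) (a₃₄ : G.Adj r₃ r₄)
    (b₁ : G.Adj r₁ p) (b₂ : G.Adj r₂ p) (b₃ : G.Adj r₃ p) (h₄ : r₄ ≠ p) :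
    G.AConnected (ZMod 3) := by
  have hp : p ∈ ({p} : Finset V) := mem_singleton_self p
  refine ((good_singleton G p).union_K4 disjoint_bot_right (by simpa using b₁.ne)
    (by simpa using b₂.ne) (by simpa using b₃.ne) (by simpa using h₄) a₁₂ a₁₃ a₁₄ a₂₃ a₂₄ a₃₄
    hp hp hp b₁ b₂ b₃).aconnected_of_three_le h3ec hdeg halpha disjoint_bot_right (by simp) ?_
    (by simp)
  exact Finset.two_lt_card.2 ⟨r₁, by simp, r₂, by simp, r₃, by simp, a₁₂.ne, a₁₃.ne, a₂₃.ne⟩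

lemma aconnected_of_two_triangles (h3ec : G.ThreeEdgeConnected)
    (hdeg : ∀ v : V, 4 ≤ G.degree v)
    (halpha : ∀ a b c : V, a ≠ b → b ≠ c → a ≠ c → G.Adj a b ∨ G.Adj b c ∨ G.Adj a c)
    {a b c d : V} (hbc : G.Adj b c) (hab : G.Adj a b) (hac : G.Adj a c) (hdb : G.Adj d b)
    (hdc : G.Adj d c) (had : a ≠ d)
    (hor : G.Adj a d ∨ ∀ x y z w, G.Adj x y → G.Adj x z → G.Adj x w → G.Adj y z → G.Adj y w →
      ¬ G.Adj z w) : G.AConnected (ZMod 3) := by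
  set L := SimpleGraph.fromEdgeSet {s(a, b), s(a, c)} with hLdef
  have hL : ∀ x y, L.Adj x y ↔ s(x, y) = s(a, b) ∨ s(x, y) = s(a, c) := by
    intro x y
    rw [hLdef, SimpleGraph.fromEdgeSet_adj, Set.mem_insert_iff, Set.mem_singleton_iff,
      and_iff_left_iff_imp]
    rintro h rfl
    have := hab.ne
    have := hac.ne
    simp only [Sym2.eq_iff] at h
    grind
  have hLG : L ≤ G := fun x y h => by
    rcases (hL x y).1 h with h | h <;> rw [← SimpleGraph.mem_edgeSet, h] <;> assumption
  have hHL : Disjoint (G \ L) L := disjoint_sdiff_self_left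
  have hGHL : (G \ L) ⊔ L = G := sdiff_sup_cancel hLG
  have hLend : ∀ x y, L.Adj x y → x = a ∨ x = b ∨ x = c := by
    intro x y h
    rw [hL, Sym2.eq_iff, Sym2.eq_iff] at h
    tauto
  have hLa : ∀ y, L.Adj a y → y = b ∨ y = c := by
    intro y h
    rw [hL, Sym2.eq_iff, Sym2.eq_iff] at h
    grind
  have hbase : Good (G \ L) L ({b, c} ∪ {d}) := by
    have hd : ¬ L.Adj d b ∧ ¬ L.Adj d c := by
      constructor <;>
      · intro h
        rcases hLend _ _ h with h | h | h
        exacts [had h.symm, hdb.ne h, hdc.ne h]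
    exact (good_pair hab hac hbc hL).insert_two hHL (by simp [hdb.ne, hdc.ne]) (by simp)
      (by simp) hbc.ne ⟨hdb, hd.1⟩ ⟨hdc, hd.2⟩
  obtain ⟨U, hsub, hU, hmax⟩ := hbase.exists_maximal
  have hbU : b ∈ U := hsub (by simp)
  have hcU : c ∈ U := hsub (by simp)
  have hdU : d ∈ U := hsub (by simp)
  have hcard : 3 ≤ U.card :=
    Finset.two_lt_card.2 ⟨b, hbU, c, hcU, d, hdU, hbc.ne, hdb.ne', hdc.ne'⟩
  by_cases haU : a ∈ U
  · refine hU.aconnected_of_three_le h3ec hdeg halpha hHL hGHL hcard fun x y h => ?_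
    rcases hLend x y h with rfl | rfl | rfl <;> assumption
  have hH : ∀ x y, x ∉ U → x ≠ a → G.Adj x y → (G \ L).Adj x y := fun x y hx hxa hxy =>
    ⟨hxy, fun h => by
      rcases hLend x y h with rfl | rfl | rfl
      exacts [hxa rfl, hx hbU, hx hcU]⟩
  have hHa : ∀ y, y ≠ b → y ≠ c → G.Adj a y → (G \ L).Adj a y := fun y hb hc hy =>
    ⟨hy, fun h => (hLa y h).elim hb hc⟩
  have hfew' : ∀ y ∉ U, ∃ w, ∀ x ∈ U, (G \ L).Adj y x → x = w := fun y hy => by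
    by_cases h : ∃ w ∈ U, (G \ L).Adj y w
    · obtain ⟨w, hw, hyw⟩ := h
      refine ⟨w, fun x hx hyx => ?_⟩
      by_contra hne
      exact hy (hmax _ (hU.insert_two hHL hy hx hw hne hyx hyw) subset_union_left (by simp))
    · exact ⟨y, fun x hx hyx => (h ⟨x, hx, hyx⟩).elim⟩
  set R := Uᶜ.erase a with hR
  have hRmem : ∀ x, x ∈ R ↔ x ≠ a ∧ x ∉ U := by simp [hR]
  have hfew : ∀ y ∈ R, ∃ w, ∀ x ∈ U, G.Adj y x → x = w := fun y hy => by
    rw [hRmem] at hy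
    obtain ⟨w, hw⟩ := hfew' y hy.2
    exact ⟨w, fun x hx hyx => hw x hx (hH _ _ hy.2 hy.1 hyx)⟩
  have hclique : ∀ y ∈ R, ∀ z ∈ R, y ≠ z → G.Adj y z := fun y hy z hz hyz =>
    adj_of_few halpha hcard ((hRmem y).1 hy).2 ((hRmem z).1 hz).2 hyz (hfew y hy) (hfew z hz)
  have hclique' : ∀ y ∈ R, ∀ z ∈ R, y ≠ z → (G \ L).Adj y z := fun y hy z hz hyz =>
    hH _ _ ((hRmem y).1 hy).2 ((hRmem y).1 hy).1 (hclique y hy z hz hyz)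
  have hRa : ∀ y ∈ R, G.Adj y a → (G \ L).Adj y a := fun y hy h =>
    hH _ _ ((hRmem y).1 hy).2 ((hRmem y).1 hy).1 h
  obtain ⟨r, hr⟩ : R.Nonempty := by
    rw [nonempty_iff_ne_empty]
    intro hempty
    obtain ⟨w, hw⟩ := hfew' a haU
    have h := four_le_card hdeg (y := a) (T := {b, c, w}) fun x hx => by
      by_cases hxb : x = b
      · simp [hxb]
      by_cases hxc : x = c
      · simp [hxc]
      have hxU : x ∈ U := by
        by_contra hxU
        have : x ∈ R := (hRmem x).2 ⟨hx.ne', hxU⟩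
        simp [hempty] at this
      simp [hw x hxU (hHa x hxb hxc hx)]
    have := card_le_three (a := b) (b := c) (c := w)
    omega
  have h3 : 3 ≤ R.card := by
    obtain ⟨w, hw⟩ := hfew r hr
    have h := four_le_card hdeg (y := r) (T := insert a (insert w (R.erase r))) fun x hx => by
      by_cases hxU : x ∈ U
      · simp [hw x hxU hx]
      · simp only [mem_insert, mem_erase, hRmem]
        have := hx.ne'
        tauto
    have h1 := card_insert_le a (insert w (R.erase r))
    have h2 := card_insert_le w (R.erase r)
    rw [card_erase_of_mem hr] at h2
    omega
  have hnbr : R.card ≤ 4 → ∀ y ∈ R, ¬ G.Adj y a → ∃ u ∈ U, (G \ L).Adj y u := by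
    intro h4 y hy hya
    have hy' := (hRmem y).1 hy
    by_contra hno
    have h := four_le_card hdeg (y := y) (T := R.erase y) fun x hx => by
      by_cases hxU : x ∈ U
      · exact (hno ⟨x, hxU, hH _ _ hy'.2 hy'.1 hx⟩).elim
      · exact mem_erase.2 ⟨hx.ne', (hRmem x).2 ⟨fun h => hya (h ▸ hx), hxU⟩⟩
    rw [card_erase_of_mem hy] at h
    omega
  -- Three vertices of `R` with neighbours in `U`, completed to a `K₄` outside `U`.
  have hthree : ∀ r₁ ∈ R, ∀ r₂ ∈ R, ∀ r₃ ∈ R, ∀ r₄ ∉ U, r₁ ≠ r₂ → r₁ ≠ r₃ → r₂ ≠ r₃ →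
      (G \ L).Adj r₁ r₄ → (G \ L).Adj r₂ r₄ → (G \ L).Adj r₃ r₄ →
      (∃ u ∈ U, (G \ L).Adj r₁ u) → (∃ u ∈ U, (G \ L).Adj r₂ u) →
      (∃ u ∈ U, (G \ L).Adj r₃ u) → False := by
    rintro r₁ h₁ r₂ h₂ r₃ h₃ r₄ h₄ n₁₂ n₁₃ n₂₃ a₁ a₂ a₃ ⟨u₁, m₁, b₁⟩ ⟨u₂, m₂, b₂⟩ ⟨u₃, m₃, b₃⟩
    exact h₄ (hmax _ (hU.union_K4 hHL ((hRmem _).1 h₁).2 ((hRmem _).1 h₂).2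
      ((hRmem _).1 h₃).2 h₄ (hclique' _ h₁ _ h₂ n₁₂) (hclique' _ h₁ _ h₃ n₁₃) a₁
      (hclique' _ h₂ _ h₃ n₂₃) a₂ a₃ m₁ m₂ m₃ b₁ b₂ b₃) subset_union_left (by simp))
  rcases h3.eq_or_lt with h3' | h4
  · exfalso
    have hadj : ∀ y ∈ R, G.Adj y a := by
      intro y hy
      by_contra hya
      obtain ⟨w, hw⟩ := hfew y hy
      have h := four_le_card hdeg (y := y) (T := insert w (R.erase y)) fun x hx => by
        by_cases hxU : x ∈ U
        · simp [hw x hxU hx]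
        · exact mem_insert_of_mem
            (mem_erase.2 ⟨hx.ne', (hRmem x).2 ⟨fun h => hya (h ▸ hx), hxU⟩⟩)
      have h2 := card_insert_le w (R.erase y)
      rw [card_erase_of_mem hy] at h2
      omega
    have hnbr' : ∀ y ∈ R, ∃ u ∈ U, (G \ L).Adj y u := by
      intro y hy
      have hy' := (hRmem y).1 hy
      by_contra hno
      have h := four_le_card hdeg (y := y) (T := insert a (R.erase y)) fun x hx => by
        by_cases hxU : x ∈ U
        · exact (hno ⟨x, hxU, hH _ _ hy'.2 hy'.1 hx⟩).elim
        · simp only [mem_insert, mem_erase, hRmem]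
          have := hx.ne'
          tauto
      have h2 := card_insert_le a (R.erase y)
      rw [card_erase_of_mem hy] at h2
      omega
    obtain ⟨r₁, h₁, r₂, h₂, r₃, h₃, n₁₂, n₁₃, n₂₃⟩ := Finset.two_lt_card.1 h3
    exact hthree r₁ h₁ r₂ h₂ r₃ h₃ a haU n₁₂ n₁₃ n₂₃ (hRa _ h₁ (hadj _ h₁))
      (hRa _ h₂ (hadj _ h₂)) (hRa _ h₃ (hadj _ h₃)) (hnbr' _ h₁) (hnbr' _ h₂) (hnbr' _ h₃)
  -- A fourth vertex of `R` next to three given ones.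
  have hfourth : ∀ x y z, ∃ w ∈ R, w ≠ x ∧ w ≠ y ∧ w ≠ z := by
    intro x y z
    obtain ⟨w, hw, hw'⟩ := Finset.exists_mem_notMem_of_card_lt_card
      (show ({x, y, z} : Finset V).card < R.card from card_le_three.trans_lt h4)
    exact ⟨w, hw, by simpa using hw'⟩
  by_cases h5 : 5 ≤ R.card
  · obtain ⟨r₁, h₁, r₂, h₂, r₃, h₃, r₄, h₄, n₁₂, n₁₃, n₁₄, n₂₃, n₂₄, n₃₄⟩ := exists_four h4
    obtain ⟨p, hp, hp'⟩ := Finset.exists_mem_notMem_of_card_lt_card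
      (show ({r₁, r₂, r₃, r₄} : Finset V).card < R.card from card_le_four.trans_lt h5)
    simp only [mem_insert, mem_singleton, not_or] at hp'
    exact aconnected_of_K4_of_three_adj h3ec hdeg halpha (hclique _ h₁ _ h₂ n₁₂)
      (hclique _ h₁ _ h₃ n₁₃) (hclique _ h₁ _ h₄ n₁₄) (hclique _ h₂ _ h₃ n₂₃)
      (hclique _ h₂ _ h₄ n₂₄) (hclique _ h₃ _ h₄ n₃₄) (hclique _ h₁ _ hp (Ne.symm hp'.1))
      (hclique _ h₂ _ hp (Ne.symm hp'.2.1)) (hclique _ h₃ _ hp (Ne.symm hp'.2.2.1))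
      (Ne.symm hp'.2.2.2)
  have hsplit := Finset.card_filter_add_card_filter_not (s := R) (fun y => G.Adj y a)
  by_cases hA : 3 ≤ (R.filter fun y => G.Adj y a).card
  · obtain ⟨r₁, h₁, r₂, h₂, r₃, h₃, n₁₂, n₁₃, n₂₃⟩ := Finset.two_lt_card.1 hA
    rw [mem_filter] at h₁ h₂ h₃
    obtain ⟨r₄, h₄, n₁₄, n₂₄, n₃₄⟩ := hfourth r₁ r₂ r₃
    exact aconnected_of_K4_of_three_adj h3ec hdeg halpha (hclique _ h₁.1 _ h₂.1 n₁₂)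
      (hclique _ h₁.1 _ h₃.1 n₁₃) (hclique _ h₁.1 _ h₄ n₁₄.symm) (hclique _ h₂.1 _ h₃.1 n₂₃)
      (hclique _ h₂.1 _ h₄ n₂₄.symm) (hclique _ h₃.1 _ h₄ n₃₄.symm) h₁.2 h₂.2 h₃.2
      ((hRmem _).1 h₄).1
  exfalso
  by_cases hB : 3 ≤ (R.filter fun y => ¬ G.Adj y a).card
  · obtain ⟨r₁, h₁, r₂, h₂, r₃, h₃, n₁₂, n₁₃, n₂₃⟩ := Finset.two_lt_card.1 hB
    rw [mem_filter] at h₁ h₂ h₃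
    obtain ⟨r₄, h₄, n₁₄, n₂₄, n₃₄⟩ := hfourth r₁ r₂ r₃
    exact hthree r₁ h₁.1 r₂ h₂.1 r₃ h₃.1 r₄ ((hRmem _).1 h₄).2 n₁₂ n₁₃ n₂₃
      (hclique' _ h₁.1 _ h₄ n₁₄.symm) (hclique' _ h₂.1 _ h₄ n₂₄.symm)
      (hclique' _ h₃.1 _ h₄ n₃₄.symm) (hnbr (by omega) _ h₁.1 h₁.2)
      (hnbr (by omega) _ h₂.1 h₂.2) (hnbr (by omega) _ h₃.1 h₃.2)
  obtain ⟨r₁, h₁, r₂, h₂, n₁₂⟩ := Finset.one_lt_card.1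
    (show 1 < (R.filter fun y => G.Adj y a).card by omega)
  obtain ⟨r₃, h₃, r₄, h₄, n₃₄⟩ := Finset.one_lt_card.1
    (show 1 < (R.filter fun y => ¬ G.Adj y a).card by omega)
  rw [mem_filter] at h₁ h₂ h₃ h₄
  have n₁₃ : r₁ ≠ r₃ := by rintro rfl; exact h₃.2 h₁.2
  have n₁₄ : r₁ ≠ r₄ := by rintro rfl; exact h₄.2 h₁.2
  have n₂₃ : r₂ ≠ r₃ := by rintro rfl; exact h₃.2 h₂.2
  have n₂₄ : r₂ ≠ r₄ := by rintro rfl; exact h₄.2 h₂.2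
  rcases hor with had' | hK4
  · obtain ⟨u₃, m₃, b₃⟩ := hnbr (by omega) _ h₃.1 h₃.2
    obtain ⟨u₄, m₄, b₄⟩ := hnbr (by omega) _ h₄.1 h₄.2
    exact haU (hmax _ (hU.union_K4_vertex hHL ((hRmem _).1 h₁.1).2 ((hRmem _).1 h₂.1).2
      ((hRmem _).1 h₃.1).2 ((hRmem _).1 h₄.1).2 haU (hclique' _ h₁.1 _ h₂.1 n₁₂)
      (hclique' _ h₁.1 _ h₃.1 n₁₃) (hclique' _ h₁.1 _ h₄.1 n₁₄) (hclique' _ h₂.1 _ h₃.1 n₂₃)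
      (hclique' _ h₂.1 _ h₄.1 n₂₄) (hclique' _ h₃.1 _ h₄.1 n₃₄) (hRa _ h₁.1 h₁.2).symm
      (hRa _ h₂.1 h₂.2).symm ((hRmem _).1 h₃.1).1.symm ((hRmem _).1 h₄.1).1.symm hdU m₃ m₄
      (hHa d hdb.ne hdc.ne had') b₃ b₄) subset_union_left (by simp))
  · exact hK4 r₁ r₂ r₃ r₄ (hclique _ h₁.1 _ h₂.1 n₁₂) (hclique _ h₁.1 _ h₃.1 n₁₃)
      (hclique _ h₁.1 _ h₄.1 n₁₄) (hclique _ h₂.1 _ h₃.1 n₂₃) (hclique _ h₂.1 _ h₄.1 n₂₄)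
      (hclique _ h₃.1 _ h₄.1 n₃₄)

lemma exists_two_triangles [Nonempty V] (hdeg : ∀ v : V, 4 ≤ G.degree v)
    (halpha : ∀ a b c : V, a ≠ b → b ≠ c → a ≠ c → G.Adj a b ∨ G.Adj b c ∨ G.Adj a c) :
    ∃ a b c d, G.Adj b c ∧ G.Adj a b ∧ G.Adj a c ∧ G.Adj d b ∧ G.Adj d c ∧ a ≠ d := by
  by_contra hcon
  have huniq : ∀ a b c d, G.Adj b c → G.Adj a b → G.Adj a c → G.Adj d b → G.Adj d c → a = d :=
    fun a b c d h1 h2 h3 h4 h5 => by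
      by_contra h; exact hcon ⟨a, b, c, d, h1, h2, h3, h4, h5, h⟩
  obtain ⟨v⟩ := ‹Nonempty V›
  obtain ⟨a, b, hva, hvb, hab⟩ : ∃ a b, G.Adj v a ∧ G.Adj v b ∧ G.Adj a b := by
    obtain ⟨x, hx, y, hy, z, hz, h1, h2, h3⟩ := Finset.two_lt_card.1
      (show 2 < (G.neighborFinset v).card from (by norm_num : 2 < 4).trans_le (hdeg v))
    rw [SimpleGraph.mem_neighborFinset] at hx hy hz
    rcases halpha x y z h1 h3 h2 with h | h | h
    exacts [⟨x, y, hx, hy, h⟩, ⟨y, z, hy, hz, h⟩, ⟨x, z, hx, hz, h⟩]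
  have hmore : ∀ x w, ∃ p q, G.Adj x p ∧ G.Adj x q ∧ p ≠ v ∧ p ≠ w ∧ q ≠ v ∧ q ≠ w ∧ p ≠ q := by
    intro x w
    have hx := hdeg x
    rw [← SimpleGraph.card_neighborFinset_eq_degree] at hx
    have h1 := (G.neighborFinset x).pred_card_le_card_erase (a := v)
    have h2 := ((G.neighborFinset x).erase v).pred_card_le_card_erase (a := w)
    obtain ⟨p, hp, q, hq, hpq⟩ := Finset.one_lt_card.1
      (show 1 < (((G.neighborFinset x).erase v).erase w).card by omega)
    simp only [mem_erase, SimpleGraph.mem_neighborFinset] at hp hq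
    exact ⟨p, q, hp.2.2, hq.2.2, hp.2.1, hp.1, hq.2.1, hq.1, hpq⟩
  obtain ⟨p, q, hap, haq, hpv, hpb, hqv, hqb, hpq⟩ := hmore a b
  obtain ⟨r, -, hbr, -, hrv, hra, -, -, -⟩ := hmore b a
  have hvr : ¬ G.Adj v r := fun h => hra (huniq r v b a hvb h.symm hbr.symm hva.symm hab)
  have hva' : ∀ x, G.Adj a x → x ≠ b → ¬ G.Adj v x := fun x h hx h' =>
    hx (huniq x v a b hva h'.symm h.symm hvb.symm hab.symm)
  have hba' : ∀ x, G.Adj a x → x ≠ v → ¬ G.Adj b x := fun x h hx h' =>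
    hx (huniq x a b v hab h.symm h'.symm hva hvb)
  have hpq' : G.Adj p q := by
    have := halpha v p q hpv.symm hpq hqv.symm
    have := hva' p hap hpb
    have := hva' q haq hqb
    tauto
  have hr' : ∀ x, G.Adj a x → x ≠ b → x ≠ v → G.Adj r x := fun x h hxb hxv => by
    have hrx : r ≠ x := by rintro rfl; exact hba' _ h hxv hbr
    have := halpha v r x hrv.symm hrx hxv.symm
    have := hva' x h hxb
    tauto
  exact hra (huniq a p q r hpq' hap haq (hr' p hap hpb hpv) (hr' q haq hqb hqv)).symm

end Graph

end ZThree

theorem stmt_2 {V : Type} [Fintype V] [DecidableEq V] (G : SimpleGraph V)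
    [DecidableRel G.Adj]
    (h3ec : G.ThreeEdgeConnected)
    (hdeg : ∀ v : V, 4 ≤ G.degree v)
    (halpha : ∀ a b c : V, a ≠ b → b ≠ c → a ≠ c → G.Adj a b ∨ G.Adj b c ∨ G.Adj a c) :
    G.AConnected (ZMod 3) := by
  cases isEmpty_or_nonempty V
  · exact fun _ _ => ⟨fun _ _ => 0, by simp, fun u => isEmptyElim u, fun u => isEmptyElim u⟩
  by_cases hK4 : ∃ x y z w, G.Adj x y ∧ G.Adj x z ∧ G.Adj x w ∧ G.Adj y z ∧ G.Adj y w ∧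
      G.Adj z w
  · obtain ⟨x, y, z, w, hxy, hxz, hxw, hyz, hyw, hzw⟩ := hK4
    exact ZThree.aconnected_of_two_triangles h3ec hdeg halpha hyz hxy hxz hyw.symm hzw.symm
      hxw.ne (Or.inl hxw)
  · obtain ⟨a, b, c, d, hbc, hab, hac, hdb, hdc, had⟩ :=
      ZThree.exists_two_triangles hdeg halpha
    exact ZThree.aconnected_of_two_triangles h3ec hdeg halpha hbc hab hac hdb hdc had
      (Or.inr fun x y z w h1 h2 h3 h4 h5 h6 => hK4 ⟨x, y, z, w, h1, h2, h3, h4, h5, h6⟩)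
end

section
/- Let G be a finite simple graph with minimum degree δ(G) ≥ 4 satisfying the Ore-condition, i.e., d(u) + d(v) ≥ |V(G)| for every pair of nonadjacent vertices u, v. Then G is Z₃-connected. -/
open Finset

namespace ZThreeConnectivity

/-- The two-edge path `a - v - b`. -/
def pathGraph {V : Type} (a v b : V) : SimpleGraph V :=
  SimpleGraph.edge a v ⊔ SimpleGraph.edge v b

theorem pathGraph_adj {V : Type} {a v b x y : V} (ha : a ≠ v) (hb : b ≠ v) :
    (pathGraph a v b).Adj x y ↔
      x = v ∧ (y = a ∨ y = b) ∨ y = v ∧ (x = a ∨ x = b) := by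
  simp only [pathGraph, SimpleGraph.sup_adj, SimpleGraph.edge_adj]
  grind

variable {V : Type} [Fintype V]

/-- `f` is a nowhere-zero `ZMod 3`-valued flow with support `E` and boundary `b`. -/
def IsFlow (E : SimpleGraph V) (f : V → V → ZMod 3) (b : V → ZMod 3) : Prop :=
  (∀ u v, f u v = -f v u) ∧ (∀ u v, E.Adj u v ↔ f u v ≠ 0) ∧ ∀ v, ∑ u, f v u = b v

theorem IsFlow.add {E F : SimpleGraph V} {f g : V → V → ZMod 3} {b c : V → ZMod 3}
    (hf : IsFlow E f b) (hg : IsFlow F g c) (h : ∀ u v, E.Adj u v → ¬F.Adj u v) :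
    IsFlow (E ⊔ F) (f + g) (b + c) := by
  obtain ⟨hf1, hf2, hf3⟩ := hf
  obtain ⟨hg1, hg2, hg3⟩ := hg
  refine ⟨fun u v => ?_, fun u v => ?_, fun v => ?_⟩
  · simp only [Pi.add_apply]
    rw [hf1 u v, hg1 u v]
    ring
  · have h1 := hf2 u v
    have h2 := hg2 u v
    have h3 := h u v
    simp only [SimpleGraph.sup_adj, Pi.add_apply]
    by_cases hE : E.Adj u v
    · have : g u v = 0 := by tauto
      simp [hE, this, h1.1 hE]
    · have : f u v = 0 := by tauto
      simp [hE, this, h2]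
  · simp [Finset.sum_add_distrib, hf3, hg3]

theorem IsFlow.sum_eq_zero {E : SimpleGraph V} {f : V → V → ZMod 3} {b : V → ZMod 3}
    (hf : IsFlow E f b) : ∑ v, b v = 0 := by
  have h : ∑ v, b v = -∑ v, b v := by
    simp_rw [← hf.2.2]
    conv_lhs => rw [Finset.sum_comm]
    simp_rw [← Finset.sum_neg_distrib]
    exact Finset.sum_congr rfl fun u _ => Finset.sum_congr rfl fun v _ => hf.1 v u
  generalize ∑ v, b v = s at h
  revert s
  decide

theorem isFlow_bot : IsFlow (⊥ : SimpleGraph V) 0 0 :=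
  ⟨by simp, by simp, by simp⟩

/-- Every graph carries a nowhere-zero flow with some boundary. -/
theorem exists_isFlow (E : SimpleGraph V) : ∃ f b, IsFlow E f b := by
  classical
  let o := Fintype.equivFin V
  refine ⟨fun u v => if E.Adj u v then (if o u < o v then 1 else -1) else 0, _,
    fun u v => ?_, fun u v => ?_, fun v => rfl⟩
  · by_cases h : E.Adj u v
    · have hne : o u ≠ o v := fun h' => h.ne (o.injective h')
      rcases lt_or_gt_of_ne hne with h1 | h1
      · simp [h, h.symm, h1, h1.not_gt]
      · simp [h, h.symm, h1, h1.not_gt]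
    · have h' : ¬E.Adj v u := fun h' => h h'.symm
      simp [h, h']
  · by_cases h : E.Adj u v <;> simp only [h, if_true, if_false, true_iff, false_iff]
    · split_ifs <;> decide
    · simp

/-- The edges of `F` can carry any nonzero value from `a` to `b`. -/
def Link [DecidableEq V] (F : SimpleGraph V) (a b : V) : Prop :=
  ∀ s : ZMod 3, s ≠ 0 → ∃ f, IsFlow F f (Pi.single a s - Pi.single b s)

theorem link_edge [DecidableEq V] {a b : V} (h : a ≠ b) : Link (SimpleGraph.edge a b) a b := by
  intro s hs
  refine ⟨fun u v => if u = a ∧ v = b then s else if u = b ∧ v = a then -s else 0,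
    fun u v => ?_, fun u v => ?_, fun v => ?_⟩
  · by_cases h1 : u = a ∧ v = b
    · obtain ⟨rfl, rfl⟩ := h1
      simp [h]
    · by_cases h2 : u = b ∧ v = a
      · obtain ⟨rfl, rfl⟩ := h2
        simp [h]
      · have h3 : ¬(v = a ∧ u = b) := fun h => h2 h.symm
        have h4 : ¬(v = b ∧ u = a) := fun h => h1 h.symm
        simp [h1, h2, h3, h4]
  · rw [SimpleGraph.edge_adj]
    beta_reduce
    split_ifs with h1 h2
    · obtain ⟨rfl, rfl⟩ := h1
      simp [h, hs]
    · obtain ⟨rfl, rfl⟩ := h2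
      simp [h.symm, hs]
    · simp only [ne_eq, not_true_eq_false, iff_false]
      grind
  · by_cases h1 : v = a
    · subst h1
      simp [h]
    · by_cases h2 : v = b
      · subst h2
        simp [h1]
      · simp [h1, h2]

theorem Link.trans [DecidableEq V] {E F : SimpleGraph V} {a b c : V} (hE : Link E a b)
    (hF : Link F b c) (h : ∀ u v, E.Adj u v → ¬F.Adj u v) : Link (E ⊔ F) a c := by
  intro s hs
  obtain ⟨f, hf⟩ := hE s hs
  obtain ⟨g, hg⟩ := hF s hs
  refine ⟨f + g, ?_⟩
  have := hf.add hg h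
  rwa [sub_add_sub_cancel] at this

theorem link_pathGraph [DecidableEq V] {a v b : V} (ha : a ≠ v) (hb : b ≠ v) (hab : a ≠ b) :
    Link (pathGraph a v b) a b := by
  refine (link_edge ha).trans (link_edge hb.symm) fun x y h1 h2 => ?_
  rw [SimpleGraph.edge_adj] at h1 h2
  grind

/-- Every zero-sum boundary supported on `H` is realised by a flow with support `E`. -/
def Blob (E : SimpleGraph V) (H : Finset V) : Prop :=
  ∀ b : V → ZMod 3, (∀ v ∉ H, b v = 0) → ∑ v, b v = 0 → ∃ f, IsFlow E f b

theorem blob_singleton (z : V) : Blob (⊥ : SimpleGraph V) {z} := by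
  intro b hb hs
  refine ⟨0, ?_⟩
  suffices h0 : b = 0 from h0 ▸ isFlow_bot
  ext v
  by_cases h : v = z
  · subst h
    rw [Finset.sum_eq_single v (fun u _ hu => hb u (by simpa using hu)) (by simp)] at hs
    simpa using hs
  · exact hb v (by simpa using h)

theorem blob_empty : Blob (⊥ : SimpleGraph V) ∅ := by
  intro b hb _
  refine ⟨0, ?_⟩
  suffices h0 : b = 0 from h0 ▸ isFlow_bot
  ext v
  exact hb v (by simp)

theorem Blob.fill {E E' : SimpleGraph V} {H : Finset V} (h : Blob E H) (hle : E ≤ E')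
    (hE : ∀ u v, E'.Adj u v → E.Adj u v ∨ (u ∈ H ∧ v ∈ H)) : Blob E' H := by
  intro b hb hs
  obtain ⟨g, c, hg⟩ := exists_isFlow (E' \ E)
  have hc : ∀ v ∉ H, c v = 0 := fun v hv => by
    rw [← hg.2.2 v]
    refine Finset.sum_eq_zero fun u _ => ?_
    by_contra hne
    have hadj := (hg.2.1 v u).2 hne
    rw [SimpleGraph.sdiff_adj] at hadj
    have := hE v u hadj.1
    tauto
  obtain ⟨f, hf⟩ := h (b - c) (fun v hv => by simp [hb v hv, hc v hv])
    (by simp [hs, hg.sum_eq_zero])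
  refine ⟨f + g, ?_⟩
  have := hf.add hg (by simp +contextual [SimpleGraph.sdiff_adj])
  rwa [sub_add_cancel, sup_sdiff_cancel_right hle] at this

theorem Blob.merge [DecidableEq V] {E₁ E₂ F₁ F₂ : SimpleGraph V} {H₁ H₂ : Finset V}
    {a₁ a₂ b₁ b₂ : V} (h₁ : Blob E₁ H₁) (h₂ : Blob E₂ H₂) (hH : Disjoint H₁ H₂)
    (hF₁ : Link F₁ a₁ b₁) (hF₂ : Link F₂ a₂ b₂) (ha₁ : a₁ ∈ H₁) (ha₂ : a₂ ∈ H₁)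
    (hb₁ : b₁ ∈ H₂) (hb₂ : b₂ ∈ H₂)
    (hE : ∀ u v, E₁.Adj u v → ¬E₂.Adj u v)
    (hEF₁ : ∀ u v, (E₁ ⊔ E₂).Adj u v → ¬F₁.Adj u v)
    (hEF₂ : ∀ u v, (E₁ ⊔ E₂ ⊔ F₁).Adj u v → ¬F₂.Adj u v) :
    Blob (E₁ ⊔ E₂ ⊔ F₁ ⊔ F₂) (H₁ ∪ H₂) := by
  intro b hb hs
  obtain ⟨s, t, hs0, ht0, hst⟩ : ∃ s t : ZMod 3, s ≠ 0 ∧ t ≠ 0 ∧ s + t = ∑ v ∈ H₁, b v := by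
    generalize ∑ v ∈ H₁, b v = β
    revert β
    decide
  obtain ⟨f₁, hf₁⟩ := hF₁ s hs0
  obtain ⟨f₂, hf₂⟩ := hF₂ t ht0
  have hsum : ∑ v ∈ H₁, b v + ∑ v ∈ H₂, b v = 0 := by
    rw [← Finset.sum_union hH, ← hs]
    exact Finset.sum_subset (Finset.subset_univ _) fun v _ hv => hb v hv
  obtain ⟨g₁, hg₁⟩ := h₁ ((fun v => if v ∈ H₁ then b v else 0) - Pi.single a₁ s - Pi.single a₂ t)
    (fun v hv => by
      have e1 : v ≠ a₁ := fun h => hv (h ▸ ha₁)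
      have e2 : v ≠ a₂ := fun h => hv (h ▸ ha₂)
      simp [hv, e1, e2])
    (by simp [Finset.sum_ite_mem, ← hst])
  obtain ⟨g₂, hg₂⟩ := h₂ ((fun v => if v ∈ H₂ then b v else 0) + Pi.single b₁ s + Pi.single b₂ t)
    (fun v hv => by
      have e1 : v ≠ b₁ := fun h => hv (h ▸ hb₁)
      have e2 : v ≠ b₂ := fun h => hv (h ▸ hb₂)
      simp [hv, e1, e2])
    (by
      simp only [Pi.add_apply, Finset.sum_add_distrib, Finset.sum_ite_mem, Finset.univ_inter,
        Finset.sum_pi_single', Finset.mem_univ, if_true]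
      rw [← hsum, ← hst]
      ring)
  refine ⟨g₁ + g₂ + f₁ + f₂, ?_⟩
  have := ((hg₁.add hg₂ hE).add hf₁ hEF₁).add hf₂ hEF₂
  convert this using 1
  ext v
  have hd : v ∈ H₁ → v ∉ H₂ := fun h h' => Finset.disjoint_left.1 hH h h'
  have hv := hb v
  simp only [Pi.add_apply, Pi.sub_apply]
  by_cases m1 : v ∈ H₁
  · simp only [m1, hd m1, if_true, if_false]
    ring
  · by_cases m2 : v ∈ H₂
    · simp only [m1, m2, if_true, if_false]
      ring
    · simp only [m1, m2, if_false, hv (by simp [m1, m2])]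
      ring

end ZThreeConnectivity

namespace ZThreeConnectivity

variable {V : Type} [Fintype V]

/-- The edges of `G` with both ends in `H`. -/
def inside {V : Type} (G : SimpleGraph V) (H : Finset V) : SimpleGraph V where
  Adj u v := G.Adj u v ∧ u ∈ H ∧ v ∈ H
  symm := ⟨fun _ _ h => ⟨h.1.symm, h.2.2, h.2.1⟩⟩
  loopless := ⟨fun _ h => h.1.ne rfl⟩

/-- `H` can be contracted once the edges of `E` are used to split off paths. -/
def Contractible (G E : SimpleGraph V) (H : Finset V) : Prop :=
  Blob (E ⊔ inside G H) H

theorem Contractible.of_le {G E : SimpleGraph V} {H : Finset V} (h : Contractible G E H)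
    (hE : E ≤ inside G H) : Contractible G ⊥ H := by
  unfold Contractible at *
  rwa [bot_sup_eq, ← sup_eq_right.2 hE]

theorem contractible_singleton (G : SimpleGraph V) (z : V) : Contractible G ⊥ {z} := by
  refine (blob_singleton z).fill bot_le ?_
  intro u v h
  simp only [SimpleGraph.sup_adj, inside] at h
  tauto

variable [DecidableEq V]

theorem Contractible.merge {G E₁ E₂ : SimpleGraph V} {H₁ H₂ : Finset V} {a₁ a₂ b₁ b₂ : V}
    (h₁ : Contractible G E₁ H₁) (h₂ : Contractible G E₂ H₂) (hH : Disjoint H₁ H₂)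
    (ha₁ : a₁ ∈ H₁) (ha₂ : a₂ ∈ H₁) (hb₁ : b₁ ∈ H₂) (hb₂ : b₂ ∈ H₂)
    (hne : a₁ ≠ a₂ ∨ b₁ ≠ b₂) (hG₁ : G.Adj a₁ b₁) (hG₂ : G.Adj a₂ b₂)
    (h11 : ¬E₁.Adj a₁ b₁) (h12 : ¬E₂.Adj a₁ b₁) (h21 : ¬E₁.Adj a₂ b₂) (h22 : ¬E₂.Adj a₂ b₂)
    (hE : ∀ u v, E₁.Adj u v → ¬E₂.Adj u v)
    (hE₁ : ∀ u v, E₁.Adj u v → u ∈ H₂ → v ∉ H₂) (hE₂ : ∀ u v, E₂.Adj u v → u ∈ H₁ → v ∉ H₁) :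
    Contractible G (E₁ ⊔ E₂) (H₁ ∪ H₂) := by
  have hd : ∀ v, v ∈ H₁ → v ∉ H₂ := fun v => fun h h' => Finset.disjoint_left.1 hH h h'
  have key := Blob.merge h₁ h₂ hH (link_edge hG₁.ne) (link_edge hG₂.ne) ha₁ ha₂ hb₁ hb₂ ?_ ?_ ?_
  · refine key.fill ?_ ?_
    · intro u v huv
      simp only [SimpleGraph.sup_adj, SimpleGraph.edge_adj, inside, Finset.mem_union] at huv ⊢
      rcases huv with ((((h | h) | (h | h)) | h) | h)
      · exact Or.inl (Or.inl h)
      · exact Or.inr ⟨h.1, Or.inl h.2.1, Or.inl h.2.2⟩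
      · exact Or.inl (Or.inr h)
      · exact Or.inr ⟨h.1, Or.inr h.2.1, Or.inr h.2.2⟩
      · obtain ⟨⟨rfl, rfl⟩ | ⟨rfl, rfl⟩, _⟩ := h
        · exact Or.inr ⟨hG₁, Or.inl ha₁, Or.inr hb₁⟩
        · exact Or.inr ⟨hG₁.symm, Or.inr hb₁, Or.inl ha₁⟩
      · obtain ⟨⟨rfl, rfl⟩ | ⟨rfl, rfl⟩, _⟩ := h
        · exact Or.inr ⟨hG₂, Or.inl ha₂, Or.inr hb₂⟩
        · exact Or.inr ⟨hG₂.symm, Or.inr hb₂, Or.inl ha₂⟩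
    · intro u v huv
      simp only [SimpleGraph.sup_adj, inside, Finset.mem_union] at huv ⊢
      rcases huv with (h | h) | h
      · exact Or.inl (Or.inl (Or.inl (Or.inl (Or.inl h))))
      · exact Or.inl (Or.inl (Or.inl (Or.inr (Or.inl h))))
      · exact Or.inr h.2
  · rintro u v (h | h) (h' | h')
    · exact hE u v h h'
    · exact hE₁ u v h h'.2.1 h'.2.2
    · exact hE₂ u v h' h.2.1 h.2.2
    · exact hd u h.2.1 h'.2.1
  · rintro u v ((h | h) | (h | h)) h' <;> rw [SimpleGraph.edge_adj] at h' <;>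
      obtain ⟨⟨rfl, rfl⟩ | ⟨rfl, rfl⟩, _⟩ := h'
    · exact h11 h
    · exact h11 h.symm
    · exact hd _ h.2.2 hb₁
    · exact hd _ h.2.1 hb₁
    · exact h12 h
    · exact h12 h.symm
    · exact hd _ ha₁ h.2.1
    · exact hd _ ha₁ h.2.2
  · rintro u v (((h | h) | (h | h)) | h) h' <;> rw [SimpleGraph.edge_adj] at h' <;>
      obtain ⟨⟨rfl, rfl⟩ | ⟨rfl, rfl⟩, _⟩ := h'
    · exact h21 h
    · exact h21 h.symm
    · exact hd _ h.2.2 hb₂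
    · exact hd _ h.2.1 hb₂
    · exact h22 h
    · exact h22 h.symm
    · exact hd _ ha₂ h.2.1
    · exact hd _ ha₂ h.2.2
    all_goals
      rw [SimpleGraph.edge_adj] at h
      obtain ⟨⟨rfl, rfl⟩ | ⟨rfl, rfl⟩, _⟩ := h
    · exact hne.elim (fun h => h rfl) (fun h => h rfl)
    · exact hd _ ha₁ hb₂
    · exact hd _ ha₁ hb₂
    · exact hne.elim (fun h => h rfl) (fun h => h rfl)

theorem Contractible.absorb {G E : SimpleGraph V} {H : Finset V} {z a b : V}
    (h : Contractible G E H) (hz : z ∉ H) (ha : a ∈ H) (hb : b ∈ H) (hab : a ≠ b)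
    (hza : G.Adj z a) (hzb : G.Adj z b) (hEa : ¬E.Adj z a) (hEb : ¬E.Adj z b) :
    Contractible G E (insert z H) := by
  have key := h.merge (contractible_singleton G z) (Finset.disjoint_singleton_right.2 hz) ha hb
    (Finset.mem_singleton_self z) (Finset.mem_singleton_self z) (Or.inl hab) hza.symm hzb.symm
    (fun h => hEa h.symm) (by simp) (fun h => hEb h.symm) (by simp) (by simp)
    (by
      intro u v huv hu hv
      rw [Finset.mem_singleton] at hu hv
      exact huv.ne (hu.trans hv.symm))
    (by simp)
  rwa [sup_bot_eq, Finset.union_comm, ← Finset.insert_eq] at key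

theorem exists_closed {G E : SimpleGraph V} {H₀ W : Finset V} (h : Contractible G E H₀)
    (hW : H₀ ⊆ W) : ∃ H, H₀ ⊆ H ∧ H ⊆ W ∧ Contractible G E H ∧
      ∀ z ∈ W, z ∉ H → ∀ a ∈ H, ∀ b ∈ H, a ≠ b → G.Adj z a → G.Adj z b → ¬E.Adj z a →
        E.Adj z b := by
  by_cases hc : ∀ z ∈ W, z ∉ H₀ → ∀ a ∈ H₀, ∀ b ∈ H₀, a ≠ b → G.Adj z a → G.Adj z b →
      ¬E.Adj z a → E.Adj z b
  · exact ⟨H₀, subset_rfl, hW, h, hc⟩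
  · push Not at hc
    obtain ⟨z, hzW, hz, a, ha, b, hb, hab, hza, hzb, hEa, hEb⟩ := hc
    have hlt : (W \ insert z H₀).card < (W \ H₀).card := by
      refine Finset.card_lt_card ⟨fun x => by simp; tauto, fun hs => ?_⟩
      have := hs (Finset.mem_sdiff.2 ⟨hzW, hz⟩)
      simp at this
    obtain ⟨H, h1, h2⟩ := exists_closed (h.absorb hz ha hb hab hza hzb hEa hEb)
      (Finset.insert_subset hzW hW)
    exact ⟨H, (Finset.subset_insert _ _).trans h1, h2⟩
termination_by (W \ H₀).card

theorem contractible_pair {G F : SimpleGraph V} {a b : V} (hab : a ≠ b) {E₁ E₂ : SimpleGraph V}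
    (h₁ : Link E₁ a b) (h₂ : Link E₂ a b) (hE : ∀ u v, E₁.Adj u v → ¬E₂.Adj u v)
    (hle : E₁ ⊔ E₂ ≤ F ⊔ inside G {a, b})
    (hF : ∀ u v, F.Adj u v → (E₁ ⊔ E₂).Adj u v) : Contractible G F {a, b} := by
  have key := Blob.merge (blob_singleton a) (blob_singleton b)
    (Finset.disjoint_singleton.2 hab) h₁ h₂ (Finset.mem_singleton_self a)
    (Finset.mem_singleton_self a) (Finset.mem_singleton_self b) (Finset.mem_singleton_self b)
    (by simp) (by simp) (by simpa using hE)
  rw [bot_sup_eq, bot_sup_eq] at key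
  refine key.fill hle ?_
  intro u v huv
  rcases huv with h | h
  · exact Or.inl (hF u v h)
  · exact Or.inr h.2

/-- Splitting off the path `a - v - b` next to the edge `ab` lets us contract `{a, b}`. -/
theorem contractible_triangle {G : SimpleGraph V} {a v b : V} (hab : G.Adj a b) (ha : a ≠ v)
    (hb : b ≠ v) : Contractible G (pathGraph a v b) {a, b} := by
  refine contractible_pair hab.ne (link_pathGraph ha hb hab.ne) (link_edge hab.ne) ?_ ?_ ?_
  · intro x y h
    rw [pathGraph_adj ha hb] at h
    rw [SimpleGraph.edge_adj]
    grind
  · refine sup_le_sup_left ?_ _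
    intro x y h
    rw [SimpleGraph.edge_adj] at h
    obtain ⟨⟨rfl, rfl⟩ | ⟨rfl, rfl⟩, _⟩ := h
    · exact ⟨hab, by simp, by simp⟩
    · exact ⟨hab.symm, by simp, by simp⟩
  · exact fun x y h => Or.inl h

/-- Splitting off two paths from `a` to `b` lets us contract `{a, b}`. -/
theorem contractible_fourCycle {G : SimpleGraph V} {a v b w : V} (hab : a ≠ b) (ha : a ≠ v)
    (hb : b ≠ v) (ha' : a ≠ w) (hb' : b ≠ w) (hvw : v ≠ w) :
    Contractible G (pathGraph a v b ⊔ pathGraph a w b) {a, b} := by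
  refine contractible_pair hab (link_pathGraph ha hb hab) (link_pathGraph ha' hb' hab) ?_
    le_sup_left fun _ _ h => h
  intro x y h
  rw [pathGraph_adj ha hb] at h
  rw [pathGraph_adj ha' hb']
  grind

/-- The wheel with four spokes. -/
theorem contractible_wheel {G : SimpleGraph V} {c p q r s : V} (hcp : G.Adj c p)
    (hcq : G.Adj c q) (hcr : G.Adj c r) (hcs : G.Adj c s) (hpq : G.Adj p q) (hqr : G.Adj q r)
    (hrs : G.Adj r s) (hsp : G.Adj s p) (hpr : p ≠ r) (hqs : q ≠ s) :
    Contractible G ⊥ {c, p, q, r, s} := by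
  have e1 := hcp.ne
  have e2 := hcq.ne
  have e3 := hcr.ne
  have e4 := hcs.ne
  have e5 := hpq.ne
  have e6 := hqr.ne
  have e7 := hrs.ne
  have e8 := hsp.ne
  have signs : ∀ b₁ b₂ b₃ b₄ : ZMod 3, ∃ r₁ r₂ r₃ r₄ : ZMod 3, r₁ ≠ 0 ∧ r₂ ≠ 0 ∧ r₃ ≠ 0 ∧
      r₄ ≠ 0 ∧ b₁ - r₁ + r₄ ≠ 0 ∧ b₂ - r₂ + r₁ ≠ 0 ∧ b₃ - r₃ + r₂ ≠ 0 ∧ b₄ - r₄ + r₃ ≠ 0 := by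
    decide
  have hblob : Blob (SimpleGraph.edge p q ⊔ SimpleGraph.edge q r ⊔ SimpleGraph.edge r s ⊔
      SimpleGraph.edge s p ⊔ SimpleGraph.edge p c ⊔ SimpleGraph.edge q c ⊔
      SimpleGraph.edge r c ⊔ SimpleGraph.edge s c) {c, p, q, r, s} := by
    intro b hb hsum
    obtain ⟨r₁, r₂, r₃, r₄, n1, n2, n3, n4, n5, n6, n7, n8⟩ := signs (b p) (b q) (b r) (b s)
    obtain ⟨f1, h1⟩ := link_edge e5 _ n1
    obtain ⟨f2, h2⟩ := link_edge e6 _ n2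
    obtain ⟨f3, h3⟩ := link_edge e7 _ n3
    obtain ⟨f4, h4⟩ := link_edge e8 _ n4
    obtain ⟨f5, h5⟩ := link_edge e1.symm _ n5
    obtain ⟨f6, h6⟩ := link_edge e2.symm _ n6
    obtain ⟨f7, h7⟩ := link_edge e3.symm _ n7
    obtain ⟨f8, h8⟩ := link_edge e4.symm _ n8
    have key := (((((((h1.add h2 ?_).add h3 ?_).add h4 ?_).add h5 ?_).add h6 ?_).add h7
      ?_).add h8 ?_)
    · refine ⟨f1 + f2 + f3 + f4 + f5 + f6 + f7 + f8, ?_⟩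
      convert key using 1
      ext v
      have hc : b c = -(b p + b q + b r + b s) := by
        rw [← Finset.sum_subset (Finset.subset_univ {c, p, q, r, s})
          (fun v _ hv => hb v hv)] at hsum
        rw [Finset.sum_insert (by simp [e1, e2, e3, e4]),
          Finset.sum_insert (by simp [e5, e8.symm, hpr]),
          Finset.sum_insert (by simp [e6, hqs]), Finset.sum_insert (by simp [e7]),
          Finset.sum_singleton] at hsum
        linear_combination hsum
      simp only [Pi.add_apply, Pi.sub_apply]
      by_cases m1 : v = p
      · subst m1
        simp [e1.symm, e5, e8.symm, hpr]
        ring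
      by_cases m2 : v = q
      · subst m2
        simp [e2.symm, e5.symm, e6, hqs]
        ring
      by_cases m3 : v = r
      · subst m3
        simp [e3.symm, e7, e6.symm, hpr.symm]
        ring
      by_cases m4 : v = s
      · subst m4
        simp [e4.symm, e8, e7.symm, hqs.symm]
        ring
      by_cases m5 : v = c
      · subst m5
        simp [e1, e2, e3, e4, hc]
        ring
      · simp [m1, m2, m3, m4, m5, hb v]
    all_goals
      intro x y hx hy
      simp only [SimpleGraph.sup_adj, SimpleGraph.edge_adj] at hx hy
      grind
  refine hblob.fill ?_ ?_
  · intro x y h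
    simp only [SimpleGraph.sup_adj, SimpleGraph.edge_adj] at h
    refine Or.inr ?_
    rcases h with ((((((h | h) | h) | h) | h) | h) | h) | h <;>
      obtain ⟨⟨rfl, rfl⟩ | ⟨rfl, rfl⟩, _⟩ := h <;>
      refine ⟨?_, by simp, by simp⟩ <;> first | assumption | exact SimpleGraph.Adj.symm (by assumption)
  · rintro x y (h | h)
    · exact absurd h (by simp)
    · exact Or.inr h.2

end ZThreeConnectivity

namespace ZThreeConnectivity

variable {V : Type} {G : SimpleGraph V} [DecidableRel G.Adj]

/-- The number of neighbours of `v` in `A`. -/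
def dg (G : SimpleGraph V) [DecidableRel G.Adj] (A : Finset V) (v : V) : ℕ :=
  #{w ∈ A | G.Adj v w}

theorem dg_mono {A B : Finset V} (h : A ⊆ B) (v : V) : dg G A v ≤ dg G B v :=
  Finset.card_le_card (Finset.filter_subset_filter _ h)

theorem dg_singleton (a v : V) : dg G {a} v = if G.Adj v a then 1 else 0 := by
  unfold dg
  rw [Finset.filter_singleton]
  split_ifs <;> rfl

theorem dg_le_card (A : Finset V) (v : V) : dg G A v ≤ #A :=
  Finset.card_filter_le _ _

theorem dg_lt_card_of_not_adj {A : Finset V} {v w : V} (hw : w ∈ A) (h : ¬G.Adj v w) :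
    dg G A v < #A :=
  Finset.card_lt_card (Finset.filter_ssubset.2 ⟨w, hw, h⟩)

theorem dg_lt_card {A : Finset V} {v : V} (h : v ∈ A) : dg G A v < #A :=
  dg_lt_card_of_not_adj h G.irrefl

theorem adj_of_card_le_dg {A : Finset V} {v w : V} (hw : w ∈ A) (h : #A ≤ dg G A v) :
    G.Adj v w := by
  by_contra hadj
  exact absurd (dg_lt_card_of_not_adj hw hadj) (by omega)

theorem dg_pos_iff {A : Finset V} {v : V} : 1 ≤ dg G A v ↔ ∃ w ∈ A, G.Adj v w := by
  unfold dg
  rw [Nat.succ_le_iff, Finset.card_pos]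
  simp [Finset.Nonempty]

theorem one_le_dg {A : Finset V} {v w : V} (hw : w ∈ A) (h : G.Adj v w) : 1 ≤ dg G A v :=
  dg_pos_iff.2 ⟨w, hw, h⟩

theorem exists_adj_of_two_le_dg {A : Finset V} {v : V} (h : 2 ≤ dg G A v) :
    ∃ a ∈ A, ∃ b ∈ A, a ≠ b ∧ G.Adj v a ∧ G.Adj v b := by
  obtain ⟨a, ha, b, hb, hab⟩ := Finset.one_lt_card.1 h
  rw [Finset.mem_filter] at ha hb
  exact ⟨a, ha.1, b, hb.1, hab, ha.2, hb.2⟩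

theorem two_le_dg {A : Finset V} {v a b : V} (ha : a ∈ A) (hb : b ∈ A) (hab : a ≠ b)
    (h1 : G.Adj v a) (h2 : G.Adj v b) : 2 ≤ dg G A v :=
  Finset.one_lt_card.2 ⟨a, by simp [ha, h1], b, by simp [hb, h2], hab⟩

theorem eq_of_dg_le_one {A : Finset V} {v a b : V} (h : dg G A v ≤ 1) (ha : a ∈ A) (hb : b ∈ A)
    (h1 : G.Adj v a) (h2 : G.Adj v b) : a = b := by
  by_contra hab
  have := two_le_dg ha hb hab h1 h2
  omega

theorem exists_not_adj {A : Finset V} {v : V} (h : dg G A v < #A) : ∃ w ∈ A, ¬G.Adj v w := by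
  by_contra! hc
  unfold dg at h
  rw [Finset.filter_true_of_mem hc] at h
  exact lt_irrefl _ h

theorem card_le_dg {A : Finset V} {v : V} (h : ∀ w ∈ A, G.Adj v w) : #A ≤ dg G A v := by
  by_contra! hlt
  obtain ⟨w, hw, hadj⟩ := exists_not_adj hlt
  exact hadj (h w hw)

theorem card_filter_not_adj (A : Finset V) (v : V) :
    #{w ∈ A | ¬G.Adj v w} + dg G A v = #A := by
  unfold dg
  rw [add_comm]
  exact Finset.card_filter_add_card_filter_not _

theorem sum_dg_comm (A B : Finset V) : ∑ u ∈ A, dg G B u = ∑ v ∈ B, dg G A v := by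
  have := Finset.sum_card_bipartiteAbove_eq_sum_card_bipartiteBelow (s := A) (t := B) G.Adj
  simp only [Finset.bipartiteAbove, Finset.bipartiteBelow] at this
  unfold dg
  rw [this]
  simp only [G.adj_comm]

/-- The hypotheses of the theorem for the subgraph induced on `W`. -/
structure OreSet (G : SimpleGraph V) [DecidableRel G.Adj] (W : Finset V) : Prop where
  four_le : ∀ v ∈ W, 4 ≤ dg G W v
  ore : ∀ u ∈ W, ∀ v ∈ W, u ≠ v → ¬G.Adj u v → #W ≤ dg G W u + dg G W v

theorem OreSet.of_dirac {W : Finset V} (h : ∀ v ∈ W, 4 ≤ dg G W v ∧ #W ≤ 2 * dg G W v) :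
    OreSet G W where
  four_le v hv := (h v hv).1
  ore u hu v hv _ _ := by
    have := (h u hu).2
    have := (h v hv).2
    omega

variable [DecidableEq V]

theorem dg_union {A B : Finset V} (h : Disjoint A B) (v : V) :
    dg G (A ∪ B) v = dg G A v + dg G B v := by
  unfold dg
  rw [Finset.filter_union, Finset.card_union_of_disjoint]
  exact Finset.disjoint_filter_filter h

theorem dg_insert {A : Finset V} {a : V} (h : a ∉ A) (v : V) :
    dg G (insert a A) v = dg G A v + if G.Adj v a then 1 else 0 := by
  unfold dg
  rw [Finset.filter_insert]
  split_ifs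
  · rw [Finset.card_insert_of_notMem (by simp [h])]
  · rfl

theorem dg_insert_of_not_adj {A : Finset V} {a v : V} (h : a ∉ A) (hv : ¬G.Adj v a) :
    dg G (insert a A) v = dg G A v := by
  rw [dg_insert h, if_neg hv, add_zero]

theorem dg_insert_le (A : Finset V) (a v : V) : dg G (insert a A) v ≤ dg G A v + 1 := by
  by_cases h : a ∈ A
  · rw [Finset.insert_eq_self.2 h]
    exact Nat.le_succ _
  · rw [dg_insert h]
    split_ifs <;> omega

theorem dg_insert_self (A : Finset V) (a : V) : dg G (insert a A) a = dg G A a := by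
  by_cases h : a ∈ A
  · rw [Finset.insert_eq_self.2 h]
  · exact dg_insert_of_not_adj h G.irrefl

theorem adj_of_card_le {A : Finset V} {v w : V} (hv : v ∈ A) (hw : w ∈ A) (hne : w ≠ v)
    (h : #A ≤ dg G A v + 1) : G.Adj v w := by
  by_contra hadj
  have h1 : dg G (A.erase v) v < #(A.erase v) :=
    dg_lt_card_of_not_adj (Finset.mem_erase.2 ⟨hne, hw⟩) hadj
  have h2 : dg G A v = dg G (A.erase v) v := by
    conv_lhs => rw [← Finset.insert_erase hv]
    exact dg_insert_self _ _
  have h3 := Finset.card_erase_add_one hv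
  omega

theorem dg_sdiff {A B : Finset V} (h : A ⊆ B) (v : V) :
    dg G A v + dg G (B \ A) v = dg G B v := by
  rw [← dg_union Finset.disjoint_sdiff, Finset.union_sdiff_of_subset h]

theorem dg_add_card_le {A B : Finset V} (h : A ⊆ B) (v : V) :
    dg G B v + #A ≤ dg G A v + #B := by
  have h1 := dg_sdiff (G := G) h v
  have h2 := dg_le_card (G := G) (B \ A) v
  rw [Finset.card_sdiff_of_subset h] at h2
  have := Finset.card_le_card h
  omega

theorem mul_card_le_sum {A : Finset V} {e : V → ℕ} {z : V} {c m : ℕ} (hA : A.Nonempty)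
    (hz : dg G A z ≤ 1) (he : ∀ u ∈ A, m ≤ e u) (hc : ∀ u ∈ A, ¬G.Adj z u → c ≤ e u) :
    c * (#A - 1) + m ≤ ∑ u ∈ A, e u := by
  obtain ⟨u₀, hu₀, h₀⟩ : ∃ u₀ ∈ A, ∀ u ∈ A, u ≠ u₀ → ¬G.Adj z u := by
    by_cases h : ∃ u₀ ∈ A, G.Adj z u₀
    · obtain ⟨u₀, hu₀, h₀⟩ := h
      exact ⟨u₀, hu₀, fun u hu hne hadj => hne (eq_of_dg_le_one hz hu hu₀ hadj h₀)⟩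
    · push Not at h
      obtain ⟨u₀, hu₀⟩ := hA
      exact ⟨u₀, hu₀, fun u hu _ => h u hu⟩
  rw [← Finset.add_sum_erase _ _ hu₀]
  have h1 : #(A.erase u₀) • c ≤ ∑ u ∈ A.erase u₀, e u :=
    Finset.card_nsmul_le_sum _ _ _ fun u hu => hc u (Finset.mem_of_mem_erase hu)
      (h₀ u (Finset.mem_of_mem_erase hu) (Finset.ne_of_mem_erase hu))
  rw [Finset.card_erase_of_mem hu₀, smul_eq_mul, mul_comm] at h1
  have := he u₀ hu₀
  omega

variable [Fintype V]

theorem contractible_of_three_le_dg {T : Finset V} (hT : #T = 5) (h : ∀ s ∈ T, 3 ≤ dg G T s) :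
    Contractible G ⊥ T := by
  have huniq : ∀ s ∈ T, ∀ t ∈ T, ∀ t' ∈ T, t ≠ s → t' ≠ s → ¬G.Adj s t → ¬G.Adj s t' →
      t = t' := by
    intro s hs t ht t' ht' hts hts' h1 h2
    by_contra hne
    have h3 := card_filter_not_adj (G := G) T s
    have h4 : ({s, t, t'} : Finset V) ⊆ {w ∈ T | ¬G.Adj s w} := by
      intro w hw
      simp only [Finset.mem_insert, Finset.mem_singleton] at hw
      rcases hw with rfl | rfl | rfl <;> simp [*]
    have h5 := Finset.card_le_card h4
    rw [Finset.card_eq_three.2 ⟨s, t, t', hts.symm, hts'.symm, hne, rfl⟩] at h5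
    have := h s hs
    omega
  obtain ⟨a, ha, b, hb, hab, hcom⟩ : ∃ a ∈ T, ∃ b ∈ T, a ≠ b ∧
      ∀ c ∈ T, c ≠ a → c ≠ b → G.Adj c a ∧ G.Adj c b := by
    by_cases hcl : ∃ a ∈ T, ∃ b ∈ T, a ≠ b ∧ ¬G.Adj a b
    · obtain ⟨a, ha, b, hb, hab, hadj⟩ := hcl
      refine ⟨a, ha, b, hb, hab, fun c hc hca hcb => ⟨?_, ?_⟩⟩
      · by_contra h1
        exact hcb (huniq a ha c hc b hb hca hab.symm (fun h => h1 h.symm) hadj)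
      · by_contra h1
        exact hca (huniq b hb c hc a ha hcb hab (fun h => h1 h.symm) (fun h => hadj h.symm))
    · push Not at hcl
      obtain ⟨a, ha, b, hb, hab⟩ := Finset.one_lt_card.1 (show 1 < #T by omega)
      exact ⟨a, ha, b, hb, hab, fun c hc hca hcb => ⟨hcl c hc a ha hca, hcl c hc b hb hcb⟩⟩
  have hcard : #((T.erase a).erase b) = 3 := by
    rw [Finset.card_erase_of_mem (by simp [hb, hab.symm]), Finset.card_erase_of_mem ha, hT]
  have wheel : ∀ c d e, (T.erase a).erase b = {c, d, e} → d ≠ e → G.Adj c d → G.Adj c e →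
      Contractible G ⊥ T := by
    intro c d e hcde hde hcd hce
    have hT' : T = {c, a, d, b, e} := by
      rw [← Finset.insert_erase ha, ← Finset.insert_erase (show b ∈ T.erase a by
        simp [hb, hab.symm]), hcde]
      ext w
      simp only [Finset.mem_insert, Finset.mem_singleton]
      tauto
    have key : ∀ w ∈ ({c, d, e} : Finset V), G.Adj w a ∧ G.Adj w b := by
      intro w hw
      rw [← hcde] at hw
      simp only [Finset.mem_erase] at hw
      exact hcom w hw.2.2 hw.2.1 hw.1
    have hc := key c (by simp)
    have hd := key d (by simp)
    have he := key e (by simp)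
    rw [hT']
    exact contractible_wheel hc.1 hcd hc.2 hce hd.1.symm hd.2 he.2.symm he.1 hab hde
  obtain ⟨c, d, e, hcd, hce, hde, hcde⟩ := Finset.card_eq_three.1 hcard
  have hmem : ∀ w ∈ ({c, d, e} : Finset V), w ∈ T := fun w hw => by
    rw [← hcde] at hw
    exact Finset.mem_of_mem_erase (Finset.mem_of_mem_erase hw)
  have hc := hmem c (by simp)
  have hd := hmem d (by simp)
  have he := hmem e (by simp)
  by_cases h1 : G.Adj c d
  · by_cases h2 : G.Adj c e
    · exact wheel c d e hcde hde h1 h2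
    · refine wheel d c e (hcde.trans (Finset.insert_comm _ _ _)) hce h1.symm ?_
      by_contra h3
      exact hcd (huniq e he c hc d hd hce hde (fun h => h2 h.symm) (fun h => h3 h.symm))
  · refine wheel e c d (hcde.trans (by ext; simp; tauto)) hcd ?_ ?_
    · by_contra h3
      exact hde (huniq c hc d hd e he hcd.symm hce.symm h1 (fun h => h3 h.symm))
    · by_contra h3
      exact hce (huniq d hd c hc e he hcd hde.symm (fun h => h1 h.symm) (fun h => h3 h.symm))

/-- A variant of `exists_closed` for `E` having no edges inside `W`. -/
theorem exists_dg_le_one {E : SimpleGraph V} {H₀ W : Finset V} (h : Contractible G E H₀)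
    (hW : H₀ ⊆ W) (hE : ∀ u ∈ W, ∀ v ∈ W, ¬E.Adj u v) :
    ∃ H, H₀ ⊆ H ∧ H ⊆ W ∧ Contractible G E H ∧ ∀ z ∈ W, z ∉ H → dg G H z ≤ 1 := by
  obtain ⟨H, h1, h2, h3, h4⟩ := exists_closed h hW
  refine ⟨H, h1, h2, h3, fun z hz hzH => ?_⟩
  by_contra! hlt
  obtain ⟨a, ha, b, hb, hab, hza, hzb⟩ := exists_adj_of_two_le_dg hlt
  exact hE z hz b (h2 hb) (h4 z hz hzH a ha b hb hab hza hzb (hE z hz a (h2 ha)))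

/-- A counterexample `W` all of whose proper subsets satisfy the theorem. -/
structure Minimal (G : SimpleGraph V) [DecidableRel G.Adj] (W : Finset V) : Prop where
  oreSet : OreSet G W
  of_ssubset : ∀ W' ⊂ W, OreSet G W' → Contractible G ⊥ W'
  not_contractible : ¬Contractible G ⊥ W

namespace Minimal

variable {W : Finset V}

theorem not_contractible_of_five_le (hM : Minimal G W) {H : Finset V} (hHW : H ⊆ W)
    (h5 : 5 ≤ #H) : ¬Contractible G ⊥ H := by
  intro hH
  obtain ⟨H', hHH', hH'W, hH', hone⟩ := exists_dg_le_one hH hHW (by simp)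
  have h5' : 5 ≤ #H' := h5.trans (Finset.card_le_card hHH')
  obtain ⟨R, hR⟩ : ∃ R, R = W \ H' := ⟨_, rfl⟩
  have hdisj : Disjoint H' R := hR ▸ Finset.disjoint_sdiff
  have hun : H' ∪ R = W := by rw [hR]; exact Finset.union_sdiff_of_subset hH'W
  have hcard : #W = #H' + #R := by rw [← hun, Finset.card_union_of_disjoint hdisj]
  have hdeg : ∀ w, dg G W w = dg G H' w + dg G R w := fun w => by rw [← hun, dg_union hdisj]
  have hone' : ∀ z ∈ R, dg G H' z ≤ 1 := fun z hz => by
    rw [hR, Finset.mem_sdiff] at hz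
    exact hone z hz.1 hz.2
  have hRW : R ⊆ W := hun ▸ Finset.subset_union_right
  have hne : ∀ u ∈ H', ∀ z ∈ R, z ≠ u := fun u hu z hz h =>
    Finset.disjoint_left.1 hdisj hu (h ▸ hz)
  rcases R.eq_empty_or_nonempty with hRe | hRne
  · rw [hRe, Finset.union_empty] at hun
    exact hM.not_contractible (hun ▸ hH')
  have hkey : ∀ u ∈ H', ∀ z ∈ R, ¬G.Adj z u → #R ≤ dg G R u + dg G R z := by
    intro u hu z hz hadj
    have h1 := hM.oreSet.ore z (hRW hz) u (hH'W hu) (hne u hu z hz) hadj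
    have h2 := dg_lt_card (G := G) hu
    have h3 := hone' z hz
    rw [hdeg, hdeg] at h1
    omega
  have hpos : ∀ u ∈ H', 1 ≤ dg G R u := by
    intro u hu
    obtain ⟨z, hz⟩ := hRne
    by_cases hadj : G.Adj z u
    · exact one_le_dg hz hadj.symm
    · have := hkey u hu z hz hadj
      have := dg_lt_card (G := G) hz
      omega
  have hsum : ∑ u ∈ H', dg G R u ≤ #R := by
    rw [sum_dg_comm]
    simpa using Finset.sum_le_card_nsmul R _ 1 hone'
  have hRconn : Contractible G ⊥ R := by
    refine hM.of_ssubset R ⟨hRW, fun h => ?_⟩ (.of_dirac fun z hz => ?_)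
    · have := Finset.card_le_card h
      omega
    · have h1 := mul_card_le_sum (G := G) (A := H') (e := dg G R) (z := z) (c := #R - dg G R z)
        (Finset.card_pos.1 (by omega)) (hone' z hz) hpos fun u hu hadj => by
          have := hkey u hu z hz hadj
          omega
      have h2 : (#R - dg G R z) * 4 ≤ (#R - dg G R z) * (#H' - 1) :=
        Nat.mul_le_mul_left _ (by omega)
      have h3 := dg_lt_card (G := G) hz
      omega
  obtain ⟨u₁, hu₁, u₂, hu₂, hu⟩ := Finset.one_lt_card.1 (show 1 < #H' by omega)
  obtain ⟨z₁, hz₁, h1⟩ := dg_pos_iff.1 (hpos u₁ hu₁)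
  obtain ⟨z₂, hz₂, h2⟩ := dg_pos_iff.1 (hpos u₂ hu₂)
  have := hH'.merge hRconn hdisj hu₁ hu₂ hz₁ hz₂ (.inl hu) h1 h2 (by simp) (by simp) (by simp)
    (by simp) (by simp) (by simp) (by simp)
  rw [hun, sup_bot_eq] at this
  exact hM.not_contractible this

theorem exists_dg_add_three_le (hM : Minimal G W) {S : Finset V} (hS : S ⊆ W) (h5 : 5 ≤ #S) :
    ∃ s ∈ S, dg G S s + 3 ≤ #S := by
  by_contra! hc
  obtain ⟨T, hTS, hT⟩ := Finset.exists_subset_card_eq h5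
  refine hM.not_contractible_of_five_le (hTS.trans hS) hT.ge
    (contractible_of_three_le_dg hT fun s hs => ?_)
  have h1 := hc s (hTS hs)
  have h2 := dg_add_card_le (G := G) hTS s
  omega

end Minimal

end ZThreeConnectivity

namespace ZThreeConnectivity

variable {V : Type} {G : SimpleGraph V}

theorem pathGraph_le_inside {H : Finset V} {a v b : V} (ha : G.Adj a v) (hb : G.Adj b v)
    (haH : a ∈ H) (hvH : v ∈ H) (hbH : b ∈ H) : pathGraph a v b ≤ inside G H := by
  intro x y h
  rw [pathGraph_adj ha.ne hb.ne] at h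
  rcases h with ⟨rfl, rfl | rfl⟩ | ⟨rfl, rfl | rfl⟩
  · exact ⟨ha.symm, hvH, haH⟩
  · exact ⟨hb.symm, hvH, hbH⟩
  · exact ⟨ha, haH, hvH⟩
  · exact ⟨hb, hbH, hvH⟩

variable [DecidableEq V] [Fintype V]

/-- Given a contractible `H` after splitting off `u₁ - v - u₂`, split off a second path
`z₁ - b - z₂` from a triangle `z₁ b z₂` and merge `{z₁, z₂}` with `H`. -/
theorem Contractible.merge_triangle {H : Finset V} {v u₁ u₂ b z₁ z₂ a₁ a₂ : V}
    (h : Contractible G (pathGraph u₁ v u₂) H) (hu₁ : u₁ ≠ v) (hu₂ : u₂ ≠ v) (hvH : v ∉ H)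
    (hbv : b ≠ v) (hz₁v : z₁ ≠ v) (hz₂v : z₂ ≠ v) (hbH : b ∉ H) (hz₁H : z₁ ∉ H) (hz₂H : z₂ ∉ H)
    (hz₁b : z₁ ≠ b) (hz₂b : z₂ ≠ b) (hz : G.Adj z₁ z₂) (ha₁ : a₁ ∈ H) (ha₂ : a₂ ∈ H)
    (h₁ : G.Adj z₁ a₁) (h₂ : G.Adj z₂ a₂) :
    Contractible G (pathGraph u₁ v u₂ ⊔ pathGraph z₁ b z₂) (H ∪ {z₁, z₂}) := by
  have hmem : ∀ x ∈ H, x ≠ v ∧ x ≠ b ∧ x ≠ z₁ ∧ x ≠ z₂ := fun x hx => by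
    refine ⟨?_, ?_, ?_, ?_⟩ <;> rintro rfl <;> contradiction
  have m₁ := hmem a₁ ha₁
  have m₂ := hmem a₂ ha₂
  refine h.merge (contractible_triangle hz hz₁b hz₂b) ?_ ha₁ ha₂ (b₁ := z₁) (b₂ := z₂) (by simp)
    (by simp) (.inr hz.ne) h₁.symm h₂.symm ?_ ?_ ?_ ?_ ?_ ?_ ?_
  · simp [Finset.disjoint_right, hz₁H, hz₂H]
  all_goals
    try intro x y
    rw [pathGraph_adj (by assumption) (by assumption)]
    try rw [pathGraph_adj (by assumption) (by assumption)]
    grind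

variable [DecidableRel G.Adj]

theorem Contractible.absorb_of_two_le_dg {E : SimpleGraph V} {H : Finset V} {z : V}
    (h : Contractible G E H) (hz : z ∉ H) (h2 : 2 ≤ dg G H z) (hE : ∀ a, ¬E.Adj z a) :
    Contractible G E (insert z H) := by
  obtain ⟨a, ha, b, hb, hab, hza, hzb⟩ := exists_adj_of_two_le_dg h2
  exact h.absorb hz ha hb hab hza hzb (hE a) (hE b)

theorem Contractible.absorb_of_four_le_dg {E : SimpleGraph V} {H : Finset V} {v u₁ u₂ : V}
    (h : Contractible G E H) (hv : v ∉ H) (h4 : 4 ≤ dg G H v)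
    (hE : ∀ a, E.Adj v a → a = u₁ ∨ a = u₂) : Contractible G E (insert v H) := by
  have h2 : 2 ≤ dg G ((H.erase u₁).erase u₂) v := by
    have h1 := dg_insert_le (G := G) (H.erase u₁) u₁ v
    have h2 := dg_insert_le (G := G) ((H.erase u₁).erase u₂) u₂ v
    have h3 := dg_mono (G := G) (Finset.insert_erase_subset u₁ H) v
    have h5 : dg G H v ≤ dg G (insert u₁ (H.erase u₁)) v :=
      dg_mono (fun x hx => by by_cases h : x = u₁ <;> simp [h, hx]) v
    have h6 : dg G (H.erase u₁) v ≤ dg G (insert u₂ ((H.erase u₁).erase u₂)) v :=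
      dg_mono (fun x hx => by by_cases h : x = u₂ <;> simp_all) v
    omega
  obtain ⟨a, ha, b, hb, hab, hza, hzb⟩ := exists_adj_of_two_le_dg h2
  simp only [Finset.mem_erase] at ha hb
  exact h.absorb hv ha.2.2 hb.2.2 hab hza hzb (fun h => (hE a h).elim ha.2.1 ha.1)
    (fun h => (hE b h).elim hb.2.1 hb.1)

/-- `W` is partitioned into `H`, `Q` and a common neighbour `v` of the ends of an edge `u₁ u₂`
inside `H`, where `H` becomes contractible after splitting off `u₁ - v - u₂`, and
no vertex of `Q` has two neighbours in `H`. -/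
structure Book (G : SimpleGraph V) [DecidableRel G.Adj] (W : Finset V) (v u₁ u₂ : V)
    (H Q : Finset V) : Prop where
  adj₁ : G.Adj u₁ v
  adj₂ : G.Adj u₂ v
  mem₁ : u₁ ∈ H
  mem₂ : u₂ ∈ H
  three_le : 3 ≤ #H
  notMem_left : v ∉ H
  notMem_right : v ∉ Q
  disjoint : Disjoint H Q
  union : insert v (H ∪ Q) = W
  contractible : Contractible G (pathGraph u₁ v u₂) H
  dg_le_one : ∀ z ∈ Q, dg G H z ≤ 1

theorem exists_book {W : Finset V} {v x u₁ u₂ : V} (hu : G.Adj u₁ u₂) (h₁ : G.Adj u₁ v)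
    (h₂ : G.Adj u₂ v) (hx₁ : G.Adj u₁ x) (hx₂ : G.Adj u₂ x) (hvx : v ≠ x) (hv : v ∈ W)
    (hx : x ∈ W) (hu₁ : u₁ ∈ W) (hu₂ : u₂ ∈ W) :
    ∃ H Q, Book G W v u₁ u₂ H Q ∧ {u₁, u₂, x} ⊆ H := by
  obtain ⟨H, hH, hHW, hc, hone⟩ := exists_dg_le_one (contractible_triangle hu h₁.ne h₂.ne)
    (W := W.erase v) (by
      intro w hw
      simp only [Finset.mem_insert, Finset.mem_singleton] at hw
      rcases hw with rfl | rfl <;> simp [*, h₁.ne, h₂.ne])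
    (fun a ha b hb h => by
      rw [pathGraph_adj h₁.ne h₂.ne] at h
      simp only [Finset.mem_erase] at ha hb
      tauto)
  have m₁ : u₁ ∈ H := hH (by simp)
  have m₂ : u₂ ∈ H := hH (by simp)
  have mx : x ∈ H := by
    by_contra hxH
    exact hu.ne (eq_of_dg_le_one (hone x (by simp [hx, hvx.symm]) hxH) m₁ m₂ hx₁.symm hx₂.symm)
  have hsub : {u₁, u₂, x} ⊆ H := by
    intro w hw
    simp only [Finset.mem_insert, Finset.mem_singleton] at hw
    rcases hw with rfl | rfl | rfl <;> assumption
  have hvH : v ∉ H := fun h => by simpa using hHW h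
  refine ⟨H, W \ insert v H, ⟨h₁, h₂, m₁, m₂, ?_, hvH, by simp, ?_, ?_, hc, ?_⟩, hsub⟩
  · have := Finset.card_le_card hsub
    rwa [Finset.card_eq_three.2 ⟨u₁, u₂, x, hu.ne, hx₁.ne, hx₂.ne, rfl⟩] at this
  · exact Finset.disjoint_sdiff.mono_left (Finset.subset_insert v H)
  · rw [← Finset.insert_union, Finset.union_sdiff_of_subset]
    exact Finset.insert_subset hv (hHW.trans (Finset.erase_subset _ _))
  · intro z hz
    simp only [Finset.mem_sdiff, Finset.mem_insert, not_or] at hz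
    exact hone z (by simp [hz]) hz.2.2

namespace Book

variable {W H Q : Finset V} {v u₁ u₂ : V}

theorem subset_left (hB : Book G W v u₁ u₂ H Q) : H ⊆ W :=
  hB.union ▸ Finset.subset_union_left.trans (Finset.subset_insert _ _)

theorem subset_right (hB : Book G W v u₁ u₂ H Q) : Q ⊆ W :=
  hB.union ▸ Finset.subset_union_right.trans (Finset.subset_insert _ _)

theorem mem_center (hB : Book G W v u₁ u₂ H Q) : v ∈ W :=
  hB.union ▸ Finset.mem_insert_self _ _

theorem insert_subset (hB : Book G W v u₁ u₂ H Q) : insert v Q ⊆ W :=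
  Finset.insert_subset hB.mem_center hB.subset_right

theorem ne (hB : Book G W v u₁ u₂ H Q) {u z : V} (hu : u ∈ H) (hz : z ∈ Q) : z ≠ u :=
  fun h => Finset.disjoint_left.1 hB.disjoint hu (h ▸ hz)

theorem ne_center (hB : Book G W v u₁ u₂ H Q) {z : V} (hz : z ∈ Q) : z ≠ v :=
  fun h => hB.notMem_right (h ▸ hz)

theorem card_insert (hB : Book G W v u₁ u₂ H Q) : #(insert v Q) = #Q + 1 :=
  Finset.card_insert_of_notMem hB.notMem_right

theorem card_eq (hB : Book G W v u₁ u₂ H Q) : #W = #H + #Q + 1 := by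
  rw [← hB.union, Finset.card_insert_of_notMem, Finset.card_union_of_disjoint hB.disjoint]
  simp [hB.notMem_left, hB.notMem_right]

theorem dg_eq (hB : Book G W v u₁ u₂ H Q) (w : V) :
    dg G W w = dg G H w + dg G (insert v Q) w := by
  rw [← dg_union, Finset.union_insert, hB.union]
  rw [Finset.disjoint_insert_right]
  exact ⟨hB.notMem_left, hB.disjoint⟩

theorem dg_center_le_three (hB : Book G W v u₁ u₂ H Q) (hM : Minimal G W) : dg G H v ≤ 3 := by
  by_contra! h
  have h1 := hB.contractible.absorb_of_four_le_dg (u₁ := u₁) (u₂ := u₂) hB.notMem_left h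
    fun a ha => by
      rw [pathGraph_adj hB.adj₁.ne hB.adj₂.ne] at ha
      have := hB.adj₁.ne
      have := hB.adj₂.ne
      grind
  have h2 := dg_le_card (G := G) H v
  refine hM.not_contractible_of_five_le (Finset.insert_subset hB.mem_center hB.subset_left) ?_
    (h1.of_le (pathGraph_le_inside hB.adj₁ hB.adj₂ ?_ ?_ ?_))
  · rw [Finset.card_insert_of_notMem hB.notMem_left]
    omega
  · simp [hB.mem₁]
  · simp
  · simp [hB.mem₂]

theorem three_le_dg_insert (hB : Book G W v u₁ u₂ H Q) (hM : Minimal G W) {z : V} (hz : z ∈ Q) :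
    3 ≤ dg G (insert v Q) z := by
  have h1 := hM.oreSet.four_le z (hB.subset_right hz)
  have h2 := hB.dg_le_one z hz
  rw [hB.dg_eq] at h1
  omega

theorem nonempty_right (hB : Book G W v u₁ u₂ H Q) (hM : Minimal G W) : Q.Nonempty := by
  by_contra! hQ
  have h1 := hM.oreSet.four_le v hB.mem_center
  have h2 := hB.dg_center_le_three hM
  rw [hB.dg_eq, dg_insert_self, hQ] at h1
  have h3 := dg_le_card (G := G) ∅ v
  simp only [Finset.card_empty] at h3
  omega

theorem three_le_card_right (hB : Book G W v u₁ u₂ H Q) (hM : Minimal G W) : 3 ≤ #Q := by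
  obtain ⟨z, hz⟩ := hB.nonempty_right hM
  have h1 := hB.three_le_dg_insert hM hz
  have h2 := dg_insert_le (G := G) Q v z
  have h3 := dg_lt_card (G := G) hz
  omega

theorem card_add_two_le (hB : Book G W v u₁ u₂ H Q) (hM : Minimal G W) {u z : V} (hu : u ∈ H)
    (hz : z ∈ Q) (hzu : ¬G.Adj z u) :
    #Q + 2 ≤ dg G (insert v Q) u + dg G (insert v Q) z + dg G H z := by
  have h1 := hM.oreSet.ore z (hB.subset_right hz) u (hB.subset_left hu) (hB.ne hu hz) hzu
  have h2 := dg_lt_card (G := G) hu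
  rw [hB.dg_eq, hB.dg_eq u, hB.card_eq] at h1
  omega

theorem card_le (hB : Book G W v u₁ u₂ H Q) (hM : Minimal G W) {u z : V} (hu : u ∈ H)
    (hz : z ∈ Q) (hzu : ¬G.Adj z u) : #Q ≤ dg G (insert v Q) u + dg G Q z := by
  have h1 := hB.card_add_two_le hM hu hz hzu
  have h2 := hB.dg_le_one z hz
  have h3 := dg_insert_le (G := G) Q v z
  omega

theorem one_le_dg_insert (hB : Book G W v u₁ u₂ H Q) (hM : Minimal G W) {u : V} (hu : u ∈ H) :
    1 ≤ dg G (insert v Q) u := by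
  obtain ⟨z, hz⟩ := hB.nonempty_right hM
  by_cases hadj : G.Adj z u
  · exact one_le_dg (Finset.mem_insert_of_mem hz) hadj.symm
  · have := hB.card_le hM hu hz hadj
    have := dg_lt_card (G := G) hz
    omega

theorem sum_dg (hB : Book G W v u₁ u₂ H Q) :
    ∑ u ∈ H, dg G (insert v Q) u = dg G H v + ∑ z ∈ Q, dg G H z := by
  rw [sum_dg_comm, Finset.sum_insert hB.notMem_right]

theorem sum_dg_right_le (hB : Book G W v u₁ u₂ H Q) : ∑ z ∈ Q, dg G H z ≤ #Q := by
  simpa using Finset.sum_le_card_nsmul Q _ 1 hB.dg_le_one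

theorem sum_dg_le (hB : Book G W v u₁ u₂ H Q) (hM : Minimal G W) :
    ∑ u ∈ H, dg G (insert v Q) u ≤ #Q + 3 := by
  have h1 := hB.sum_dg_right_le
  have h2 := hB.dg_center_le_three hM
  rw [hB.sum_dg]
  omega

theorem mul_add_le (hB : Book G W v u₁ u₂ H Q) (hM : Minimal G W) {z : V} {m : ℕ} (hz : z ∈ Q)
    (hm : ∀ u ∈ H, m ≤ dg G (insert v Q) u) : (#Q - dg G Q z) * (#H - 1) + m ≤ #Q + 3 := by
  refine le_trans (mul_card_le_sum ⟨u₁, hB.mem₁⟩ (hB.dg_le_one z hz) hm fun u hu hadj => ?_)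
    (hB.sum_dg_le hM)
  have := hB.card_le hM hu hz hadj
  omega

theorem false_of_dirac (hB : Book G W v u₁ u₂ H Q) (hM : Minimal G W) (h5 : 5 ≤ #Q)
    (h : ∀ z ∈ Q, 4 ≤ dg G Q z ∧ #Q ≤ 2 * dg G Q z) : False := by
  refine hM.not_contractible_of_five_le hB.subset_right h5
    (hM.of_ssubset Q ⟨hB.subset_right, fun h => ?_⟩ (.of_dirac h))
  exact hB.notMem_right (h hB.mem_center)

/-- When `#Q = 3`, the set `insert v Q` is a clique. -/
theorem of_card_right_eq_three (hB : Book G W v u₁ u₂ H Q) (hM : Minimal G W) (hQ : #Q = 3) {z : V}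
    (hz : z ∈ Q) : dg G Q z = 2 ∧ G.Adj z v ∧ dg G H z = 1 := by
  have h1 := hM.oreSet.four_le z (hB.subset_right hz)
  have h2 := hB.dg_le_one z hz
  have h3 := dg_lt_card (G := G) hz
  have h4 := dg_insert hB.notMem_right (G := G) z
  rw [hB.dg_eq] at h1
  split_ifs at h4 with h
  · exact ⟨by omega, h, by omega⟩
  · omega

end Book

end ZThreeConnectivity

namespace ZThreeConnectivity.Book

variable {V : Type} [DecidableEq V] {G : SimpleGraph V} [DecidableRel G.Adj] [Fintype V]
  {W H Q : Finset V} {v u₁ u₂ : V}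

theorem card_right_le_four (hB : Book G W v u₁ u₂ H Q) (hM : Minimal G W) (hH : 4 ≤ #H) :
    #Q ≤ 4 := by
  by_contra! hQ
  have key : ∀ z ∈ Q, 3 * (#Q - dg G Q z) ≤ #Q + 2 := fun z hz => by
    have h1 := hB.mul_add_le hM hz fun u hu => hB.one_le_dg_insert hM hu
    have h2 : (#Q - dg G Q z) * 3 ≤ (#Q - dg G Q z) * (#H - 1) :=
      Nat.mul_le_mul_left _ (by omega)
    omega
  rcases Nat.lt_or_ge 5 #Q with h6 | h5
  · refine hB.false_of_dirac hM hQ fun z hz => ?_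
    have := key z hz
    have := dg_lt_card (G := G) hz
    omega
  · obtain ⟨z, hz, h⟩ := hM.exists_dg_add_three_le hB.subset_right hQ
    have := key z hz
    omega

theorem card_right_ne_four_of_four_le (hB : Book G W v u₁ u₂ H Q) (hM : Minimal G W)
    (hH : 4 ≤ #H) : #Q ≠ 4 := by
  intro hQ
  obtain ⟨u, hu, he⟩ : ∃ u ∈ H, dg G (insert v Q) u ≤ 1 := by
    by_contra! hc
    have h1 := Finset.card_nsmul_le_sum H (fun u => dg G (insert v Q) u) 2 hc
    have h2 := hB.sum_dg_le hM
    rw [smul_eq_mul] at h1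
    omega
  have hfull : ∀ z ∈ Q, ¬G.Adj u z → 4 ≤ dg G (insert v Q) z := fun z hz hadj => by
    have h1 := hB.card_add_two_le hM hu hz fun h => hadj h.symm
    have h2 := hB.dg_le_one z hz
    omega
  have hcard := card_filter_not_adj (G := G) Q u
  have hmono := dg_mono (G := G) (Finset.subset_insert v Q) u
  obtain ⟨s, hs, hs3⟩ := hM.exists_dg_add_three_le hB.insert_subset (by rw [hB.card_insert]; omega)
  rw [hB.card_insert] at hs3
  have hsub : {z ∈ Q | ¬G.Adj u z} ⊆ insert v Q :=
    (Finset.filter_subset _ _).trans (Finset.subset_insert _ _)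
  by_cases hsS : s ∈ ({z ∈ Q | ¬G.Adj u z} : Finset V)
  · rw [Finset.mem_filter] at hsS
    have := hfull s hsS.1 hsS.2
    omega
  · have h1 : #{z ∈ Q | ¬G.Adj u z} ≤ dg G {z ∈ Q | ¬G.Adj u z} s := by
      refine card_le_dg fun w hw => (adj_of_card_le (hsub hw) hs (fun h => hsS (h ▸ hw)) ?_).symm
      rw [Finset.mem_filter] at hw
      have := hfull w hw.1 hw.2
      rw [hB.card_insert]
      omega
    have h2 := dg_mono (G := G) hsub s
    omega

theorem card_right_ne_three (hB : Book G W v u₁ u₂ H Q) (hM : Minimal G W) : #Q ≠ 3 := by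
  intro hQ
  have facts := fun z (hz : z ∈ Q) => hB.of_card_right_eq_three hM hQ hz
  obtain ⟨b, z₁, z₂, hbz₁, hbz₂, hz, hQe⟩ := Finset.card_eq_three.1 hQ
  have mb : b ∈ Q := by simp [hQe]
  have m₁ : z₁ ∈ Q := by simp [hQe]
  have m₂ : z₂ ∈ Q := by simp [hQe]
  have hadj : ∀ z ∈ Q, ∀ w ∈ Q, w ≠ z → G.Adj z w := fun z hz w hw hne =>
    adj_of_card_le hz hw hne (by have := (facts z hz).1; omega)
  have hnot : ∀ z ∈ Q, z ∉ H := fun z hz h => Finset.disjoint_left.1 hB.disjoint h hz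
  have hnb : ∀ z ∈ Q, ∃ a ∈ H, G.Adj z a := fun z hz =>
    dg_pos_iff.1 (facts z hz).2.2.ge
  obtain ⟨a₁, ha₁, h₁⟩ := hnb z₁ m₁
  obtain ⟨a₂, ha₂, h₂⟩ := hnb z₂ m₂
  obtain ⟨a, ha, h₃⟩ := hnb b mb
  have e₁ := hB.adj₁.ne
  have e₂ := hB.adj₂.ne
  have v₁ := (facts z₁ m₁).2.1
  have v₂ := (facts z₂ m₂).2.1
  have vb := (facts b mb).2.1
  have n₁ := hB.ne hB.mem₁ m₁
  have n₂ := hB.ne hB.mem₂ m₁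
  have n₃ := hB.ne hB.mem₁ m₂
  have n₄ := hB.ne hB.mem₂ m₂
  have n₅ := hB.ne hB.mem₁ mb
  have n₆ := hB.ne hB.mem₂ mb
  have n₇ := hB.ne ha m₁
  have n₈ := hB.ne ha m₂
  have n₉ : a ≠ v := fun h => hB.notMem_left (h ▸ ha)
  have k := hB.contractible.merge_triangle e₁ e₂ hB.notMem_left vb.ne v₁.ne v₂.ne (hnot b mb)
    (hnot z₁ m₁) (hnot z₂ m₂) hbz₁.symm hbz₂.symm (hadj z₁ m₁ z₂ m₂ hz.symm) ha₁ ha₂ h₁ h₂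
  have k₁ := k.absorb (z := v) (a := z₁) (b := z₂)
    (by simp [hB.notMem_left, v₁.ne.symm, v₂.ne.symm]) (by simp) (by simp) hz v₁.symm v₂.symm
    (by
      rw [SimpleGraph.sup_adj, pathGraph_adj e₁ e₂, pathGraph_adj hbz₁.symm hbz₂.symm]
      have := vb.ne
      grind)
    (by
      rw [SimpleGraph.sup_adj, pathGraph_adj e₁ e₂, pathGraph_adj hbz₁.symm hbz₂.symm]
      have := vb.ne
      grind)
  have k₂ := k₁.absorb (z := b) (a := v) (b := a)
    (by simp [hnot b mb, vb.ne, hbz₁, hbz₂]) (by simp) (by simp [ha]) n₉.symm vb h₃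
    (by
      rw [SimpleGraph.sup_adj, pathGraph_adj e₁ e₂, pathGraph_adj hbz₁.symm hbz₂.symm]
      have := vb.ne
      have := v₁.ne
      have := v₂.ne
      grind)
    (by
      rw [SimpleGraph.sup_adj, pathGraph_adj e₁ e₂, pathGraph_adj hbz₁.symm hbz₂.symm]
      have := vb.ne
      grind)
  have hW : insert b (insert v (H ∪ {z₁, z₂})) = W := by
    rw [← hB.union, hQe]
    ext w
    simp only [Finset.mem_insert, Finset.mem_union, Finset.mem_singleton]
    tauto
  rw [hW] at k₂
  refine hM.not_contractible (k₂.of_le (sup_le ?_ ?_))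
  · exact pathGraph_le_inside hB.adj₁ hB.adj₂ (hB.subset_left hB.mem₁) hB.mem_center
      (hB.subset_left hB.mem₂)
  · exact pathGraph_le_inside (hadj z₁ m₁ b mb hbz₁) (hadj z₂ m₂ b mb hbz₂)
      (hB.subset_right m₁) (hB.subset_right mb) (hB.subset_right m₂)

theorem card_left_eq_three (hB : Book G W v u₁ u₂ H Q) (hM : Minimal G W) : #H = 3 := by
  by_contra hne
  have h1 := hB.three_le
  have h2 := hB.three_le_card_right hM
  have h3 := hB.card_right_le_four hM (by omega)
  have h4 := hB.card_right_ne_four_of_four_le hM (by omega)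
  have h5 := hB.card_right_ne_three hM
  omega

theorem dg_left_le_two (hB : Book G W v u₁ u₂ H Q) (hM : Minimal G W) {u : V} (hu : u ∈ H) :
    dg G H u ≤ 2 := by
  have := dg_lt_card (G := G) hu
  have := hB.card_left_eq_three hM
  omega

theorem two_le_dg_insert (hB : Book G W v u₁ u₂ H Q) (hM : Minimal G W) {u : V} (hu : u ∈ H) :
    2 ≤ dg G (insert v Q) u := by
  have h1 := hM.oreSet.four_le u (hB.subset_left hu)
  have h2 := hB.dg_left_le_two hM hu
  rw [hB.dg_eq] at h1
  omega

theorem card_lt_five_of_subset (hB : Book G W v u₁ u₂ H Q) (hM : Minimal G W) {T : Finset V}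
    (hT : T ⊆ insert v Q) (h : ∀ t ∈ T, #Q ≤ dg G (insert v Q) t + 1) : #T < 5 := by
  by_contra! h5
  obtain ⟨s, hs, hs3⟩ := hM.exists_dg_add_three_le (hT.trans hB.insert_subset) h5
  have h1 := dg_add_card_le (G := G) hT s
  have h2 := h s hs
  rw [hB.card_insert] at h1
  omega

theorem card_le_dg_insert (hB : Book G W v u₁ u₂ H Q) (hM : Minimal G W) {u z : V} (hu : u ∈ H)
    (he : dg G (insert v Q) u ≤ 2) (hz : z ∈ Q) (hadj : ¬G.Adj u z) :
    #Q ≤ dg G (insert v Q) z + 1 := by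
  have h1 := hB.card_add_two_le hM hu hz fun h => hadj h.symm
  have h2 := hB.dg_le_one z hz
  omega

theorem card_right_le_five (hB : Book G W v u₁ u₂ H Q) (hM : Minimal G W) {u : V} (hu : u ∈ H)
    (he : dg G (insert v Q) u ≤ 2) : #Q ≤ 5 := by
  obtain ⟨S, hS⟩ : ∃ S, S = ({z ∈ Q | ¬G.Adj u z} : Finset V) := ⟨_, rfl⟩
  have hSQ : S ⊆ Q := hS ▸ Finset.filter_subset _ _
  have hSR : S ⊆ insert v Q := hSQ.trans (Finset.subset_insert _ _)
  have hfull : ∀ z ∈ S, #Q ≤ dg G (insert v Q) z + 1 := fun z hz => by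
    rw [hS, Finset.mem_filter] at hz
    exact hB.card_le_dg_insert hM hu he hz.1 hz.2
  have h1 := hB.card_lt_five_of_subset hM hSR hfull
  have h2 := card_filter_not_adj (G := G) Q u
  have h3 := dg_mono (G := G) (Finset.subset_insert v Q) u
  rw [← hS] at h2
  by_contra! h6
  have hcard : #(insert v Q \ S) = 3 := by
    rw [Finset.card_sdiff_of_subset hSR, hB.card_insert]
    omega
  obtain ⟨p, hp, hp3⟩ : ∃ p ∈ insert v Q \ S, 3 ≤ dg G S p := by
    by_contra! hc
    have h4 := Finset.sum_le_card_nsmul (insert v Q \ S) (fun p => dg G S p) 2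
      fun p hp => Nat.le_of_lt_succ (hc p hp)
    have h5 := Finset.card_nsmul_le_sum S (fun s => dg G (insert v Q \ S) s) 2 fun s hs => by
      have h7 := hfull s hs
      have h8 := dg_lt_card (G := G) hs
      have h9 := dg_sdiff (G := G) hSR s
      omega
    rw [sum_dg_comm, smul_eq_mul] at h4
    rw [smul_eq_mul] at h5
    omega
  rw [Finset.mem_sdiff] at hp
  have hT : insert p S ⊆ insert v Q := Finset.insert_subset hp.1 hSR
  have hTcard : #(insert p S) = 5 := by
    rw [Finset.card_insert_of_notMem hp.2]
    omega
  obtain ⟨s, hs, hs3⟩ := hM.exists_dg_add_three_le (hT.trans hB.insert_subset) hTcard.ge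
  rw [Finset.mem_insert] at hs
  rcases hs with rfl | hs
  · rw [dg_insert_self] at hs3
    omega
  · have h4 := dg_add_card_le (G := G) hT s
    have h5 := hfull s hs
    rw [hB.card_insert] at h4
    omega

theorem card_right_lt_seven (hB : Book G W v u₁ u₂ H Q) (hM : Minimal G W) : #Q < 7 := by
  by_contra! hQ
  have hH := hB.card_left_eq_three hM
  have he : ∀ u ∈ H, 3 ≤ dg G (insert v Q) u := fun u hu => by
    by_contra! hlt
    have := hB.card_right_le_five hM hu (by omega)
    omega
  refine hB.false_of_dirac hM (by omega) fun z hz => ?_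
  have h1 := hB.mul_add_le hM hz he
  rw [hH] at h1
  omega

/-- Both bounds behind `sum_dg_le` hold with equality. -/
theorem tight_of_le_sum (hB : Book G W v u₁ u₂ H Q) (hM : Minimal G W)
    (h : #Q + 3 ≤ ∑ u ∈ H, dg G (insert v Q) u) : dg G H v = 3 ∧ ∀ z ∈ Q, dg G H z = 1 := by
  have h1 := hB.sum_dg_right_le
  have h2 := hB.dg_center_le_three hM
  rw [hB.sum_dg] at h
  refine ⟨by omega, fun z hz => (hB.dg_le_one z hz).antisymm ?_⟩
  by_contra! hlt
  have h3 : ∑ z ∈ Q, dg G H z < ∑ z ∈ Q, 1 :=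
    Finset.sum_lt_sum hB.dg_le_one ⟨z, hz, hlt⟩
  rw [Finset.sum_const, smul_eq_mul] at h3
  omega

theorem card_right_ne_four (hB : Book G W v u₁ u₂ H Q) (hM : Minimal G W) : #Q ≠ 4 := by
  intro hQ
  have hH := hB.card_left_eq_three hM
  obtain ⟨s, hs, hs3⟩ := hM.exists_dg_add_three_le hB.insert_subset (by rw [hB.card_insert]; omega)
  rw [hB.card_insert] at hs3
  have hv : dg G Q v ≤ 2 := by
    rw [Finset.mem_insert] at hs
    rcases hs with rfl | hs
    · rw [dg_insert_self] at hs3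
      omega
    · have := hB.three_le_dg_insert hM hs
      omega
  have hsum : 3 ≤ ∑ z ∈ Q, dg G H z := by
    have h1 := Finset.card_nsmul_le_sum H (fun u => dg G (insert v Q) u) 2
      fun u hu => hB.two_le_dg_insert hM hu
    have h2 := hB.sum_dg
    have h3 := hB.dg_center_le_three hM
    rw [smul_eq_mul] at h1
    omega
  obtain ⟨z₁, hz₁, z₂, hz₂, hz⟩ := Finset.one_lt_card.1
    (show 1 < #{z ∈ Q | ¬G.Adj v z} by
      have := card_filter_not_adj (G := G) Q v
      omega)
  rw [Finset.mem_filter] at hz₁ hz₂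
  obtain ⟨m₁, hv₁⟩ := hz₁
  obtain ⟨m₂, hv₂⟩ := hz₂
  have hfull : ∀ z ∈ Q, ¬G.Adj v z → (∀ w ∈ Q, w ≠ z → G.Adj z w) ∧ ∃ a ∈ H, G.Adj z a := by
    intro z hz hvz
    have h1 := hB.three_le_dg_insert hM hz
    have h2 := hM.oreSet.four_le z (hB.subset_right hz)
    have h3 := dg_lt_card (G := G) hz
    rw [hB.dg_eq] at h2
    rw [dg_insert_of_not_adj hB.notMem_right fun h => hvz h.symm] at h1 h2
    exact ⟨fun w hw hne => adj_of_card_le hz hw hne (by omega), dg_pos_iff.1 (by omega)⟩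
  obtain ⟨f₁, a₁, ha₁, ha₁'⟩ := hfull z₁ m₁ hv₁
  obtain ⟨f₂, a₂, ha₂, ha₂'⟩ := hfull z₂ m₂ hv₂
  have hnot : ∀ z ∈ Q, z ∉ H := fun z hz h => Finset.disjoint_left.1 hB.disjoint h hz
  have main : ∀ s t, Q = {s, t, z₁, z₂} → s ≠ t → s ≠ z₁ → s ≠ z₂ → t ≠ z₁ → t ≠ z₂ →
      1 ≤ dg G H s → False := by
    intro s t hQe hst hs₁ hs₂ ht₁ ht₂ hsH
    obtain ⟨a, ha, has⟩ := dg_pos_iff.1 hsH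
    have ms : s ∈ Q := by simp [hQe]
    have mt : t ∈ Q := by simp [hQe]
    have e₁ := hB.adj₁.ne
    have e₂ := hB.adj₂.ne
    have vs := hB.ne_center ms
    have vt := hB.ne_center mt
    have v₁ := hB.ne_center m₁
    have v₂ := hB.ne_center m₂
    have k := hB.contractible.merge_triangle e₁ e₂ hB.notMem_left v₁ vs v₂ (hnot z₁ m₁)
      (hnot s ms) (hnot z₂ m₂) hs₁ hz.symm (f₂ s ms hs₂).symm ha ha₂ has ha₂'
    have hE : ∀ x y, (pathGraph u₁ v u₂ ⊔ pathGraph s z₁ z₂).Adj x y ↔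
        (x = v ∧ (y = u₁ ∨ y = u₂) ∨ y = v ∧ (x = u₁ ∨ x = u₂)) ∨
          (x = z₁ ∧ (y = s ∨ y = z₂) ∨ y = z₁ ∧ (x = s ∨ x = z₂)) := fun x y => by
      rw [SimpleGraph.sup_adj, pathGraph_adj e₁ e₂, pathGraph_adj hs₁ hz.symm]
    have k₁ := k.absorb_of_two_le_dg (z := t)
      (by simp [hnot t mt, hst.symm, ht₂])
      (by
        have h1 := hM.oreSet.four_le t (hB.subset_right mt)
        have h2 : dg G W t ≤ dg G (insert v (insert z₁ (insert t (H ∪ {s, z₂})))) t := by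
          refine dg_mono ?_ t
          rw [← hB.union, hQe]
          intro w
          simp only [Finset.mem_insert, Finset.mem_union, Finset.mem_singleton]
          tauto
        have h3 := dg_insert_le (G := G) (insert z₁ (insert t (H ∪ {s, z₂}))) v t
        have h4 := dg_insert_le (G := G) (insert t (H ∪ {s, z₂})) z₁ t
        rw [dg_insert_self] at h4
        omega)
      fun y => by
        rw [hE]
        have := hB.ne hB.mem₁ mt
        have := hB.ne hB.mem₂ mt
        grind
    have k₂ := k₁.absorb_of_four_le_dg (v := v) (u₁ := u₁) (u₂ := u₂)
      (by simp [hB.notMem_left, vs.symm, vt.symm, v₂.symm])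
      (by
        have h1 := hM.oreSet.four_le v hB.mem_center
        have h2 : dg G W v ≤ dg G (insert v (insert z₁ (insert t (H ∪ {s, z₂})))) v := by
          refine dg_mono ?_ v
          rw [← hB.union, hQe]
          intro w
          simp only [Finset.mem_insert, Finset.mem_union, Finset.mem_singleton]
          tauto
        rw [dg_insert_self, dg_insert_of_not_adj _ hv₁] at h2
        · omega
        · simp [hnot z₁ m₁, hz, hs₁.symm, ht₁.symm])
      fun y => by
        rw [hE]
        grind
    have k₃ := k₂.absorb (z := z₁) (a := t) (b := a₁)
      (by simp [hnot z₁ m₁, hz, hs₁.symm, ht₁.symm, v₁]) (by simp) (by simp [ha₁])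
      (hB.ne ha₁ mt) (f₁ t mt ht₁) ha₁'
      (by
        rw [hE]
        have := hB.ne hB.mem₁ m₁
        have := hB.ne hB.mem₂ m₁
        grind)
      (by
        rw [hE]
        have := hB.ne ha₁ ms
        have := hB.ne ha₁ m₂
        have := hB.ne ha₁ m₁
        have : a₁ ≠ v := fun h => hB.notMem_left (h ▸ ha₁)
        grind)
    have hW : insert z₁ (insert v (insert t (H ∪ {s, z₂}))) = W := by
      rw [← hB.union, hQe]
      ext w
      simp only [Finset.mem_insert, Finset.mem_union, Finset.mem_singleton]
      tauto
    rw [hW] at k₃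
    refine hM.not_contractible (k₃.of_le (sup_le ?_ ?_))
    · exact pathGraph_le_inside hB.adj₁ hB.adj₂ (hB.subset_left hB.mem₁) hB.mem_center
        (hB.subset_left hB.mem₂)
    · exact pathGraph_le_inside (f₁ s ms hs₁).symm (f₁ z₂ m₂ hz.symm).symm
        (hB.subset_right ms) (hB.subset_right m₁) (hB.subset_right m₂)
  have m₂' : z₂ ∈ Q.erase z₁ := by simp [m₂, hz.symm]
  obtain ⟨s, t, hst, hQst⟩ := Finset.card_eq_two.1 (show #((Q.erase z₁).erase z₂) = 2 by
    rw [Finset.card_erase_of_mem m₂', Finset.card_erase_of_mem m₁]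
    omega)
  have hQe : Q = {s, t, z₁, z₂} := by
    rw [← Finset.insert_erase m₁, ← Finset.insert_erase m₂', hQst]
    ext w
    simp only [Finset.mem_insert, Finset.mem_singleton]
    tauto
  have hs : s ∈ (Q.erase z₁).erase z₂ := by simp [hQst]
  have ht : t ∈ (Q.erase z₁).erase z₂ := by simp [hQst]
  simp only [Finset.mem_erase] at hs ht
  by_cases hsH : 1 ≤ dg G H s
  · exact main s t hQe hst hs.2.1 hs.1 ht.2.1 ht.1 hsH
  by_cases htH : 1 ≤ dg G H t
  · exact main t s (hQe.trans (Finset.insert_comm _ _ _)) hst.symm ht.2.1 ht.1 hs.2.1 hs.1 htH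
  · have h1 := hB.dg_le_one z₁ m₁
    have h2 := hB.dg_le_one z₂ m₂
    rw [hQe, Finset.sum_insert (by simp [hst, hs.1, hs.2.1]),
      Finset.sum_insert (by simp [ht.1, ht.2.1]), Finset.sum_pair hz] at hsum
    omega

theorem tight (hB : Book G W v u₁ u₂ H Q) (hM : Minimal G W) :
    dg G H v = 3 ∧ ∀ z ∈ Q, dg G H z = 1 := by
  refine hB.tight_of_le_sum hM ?_
  have hH := hB.card_left_eq_three hM
  have h3 := hB.three_le_card_right hM
  have h3' := hB.card_right_ne_three hM
  have h4 := hB.card_right_ne_four hM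
  have h7 := hB.card_right_lt_seven hM
  have htwo := fun u (hu : u ∈ H) => hB.two_le_dg_insert hM hu
  have huniq : ∀ u ∈ H, ∀ u' ∈ H, u ≠ u' → dg G (insert v Q) u ≤ 2 →
      3 ≤ dg G (insert v Q) u' := by
    intro u hu u' hu' hne he
    by_contra! he'
    have := hB.card_lt_five_of_subset hM (Finset.subset_insert v Q) fun z hz => by
      by_cases hadj : G.Adj u z
      · refine hB.card_le_dg_insert hM hu' (by omega) hz fun hadj' => hne ?_
        exact eq_of_dg_le_one (hB.dg_le_one z hz) hu hu' hadj.symm hadj'.symm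
      · exact hB.card_le_dg_insert hM hu he hz hadj
    omega
  have hfive := fun u (hu : u ∈ H) => hB.card_right_le_five hM hu
  obtain ⟨a, b, c, hab, hac, hbc, rfl⟩ := Finset.card_eq_three.1 hH
  rw [Finset.sum_insert (by simp [hab, hac]), Finset.sum_pair hbc]
  have := htwo a (by simp)
  have := htwo b (by simp)
  have := htwo c (by simp)
  have := huniq a (by simp) b (by simp) hab
  have := huniq a (by simp) c (by simp) hac
  have := huniq b (by simp) c (by simp) hbc
  have := huniq b (by simp) a (by simp) hab.symm
  have := hfive a (by simp)
  have := hfive b (by simp)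
  have := hfive c (by simp)
  omega

end ZThreeConnectivity.Book

namespace ZThreeConnectivity

variable {V : Type} {G : SimpleGraph V}

/-- Every edge inside `W` has at most one common neighbour in `W`. -/
def Sparse (G : SimpleGraph V) (W : Finset V) : Prop :=
  ∀ a ∈ W, ∀ b ∈ W, G.Adj a b → ∀ c ∈ W, ∀ d ∈ W, G.Adj a c → G.Adj b c → G.Adj a d →
    G.Adj b d → c = d

theorem Sparse.not_adj_of_common {W : Finset V} (hS : Sparse G W) {a b c d : V} (ha : a ∈ W)
    (hb : b ∈ W) (hc : c ∈ W) (hd : d ∈ W) (hcd : c ≠ d) (hac : G.Adj a c) (hbc : G.Adj b c)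
    (had : G.Adj a d) (hbd : G.Adj b d) : ¬G.Adj a b :=
  fun h => hcd (hS a ha b hb h c hc d hd hac hbc had hbd)

variable [DecidableRel G.Adj] {W : Finset V}

theorem Minimal.nonempty [Fintype V] (hM : Minimal G W) : W.Nonempty := by
  by_contra! hW
  refine hM.not_contractible ?_
  rw [hW]
  exact blob_empty.fill bot_le fun u v h => h.imp id fun h => h.2

variable [DecidableEq V]

theorem Sparse.dg_add_dg_le (hS : Sparse G W) {A : Finset V} (hA : A ⊆ W) {a b : V} (ha : a ∈ W)
    (hb : b ∈ W) (hab : G.Adj a b) : dg G A a + dg G A b ≤ #A + 1 := by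
  unfold dg
  rw [← Finset.card_union_add_card_inter]
  refine add_le_add (Finset.card_le_card ?_) (Finset.card_le_one.2 fun c hc d hd => ?_)
  · exact Finset.union_subset (Finset.filter_subset _ _) (Finset.filter_subset _ _)
  · simp only [Finset.mem_inter, Finset.mem_filter] at hc hd
    exact hS a ha b hb hab c (hA hc.1.1) d (hA hd.1.1) hc.1.2 hc.2.2 hd.1.2 hd.2.2

theorem Sparse.card_le_two_mul_dg (hS : Sparse G W) (hW : OreSet G W) {l : V} (hl : l ∈ W) :
    #W ≤ 2 * dg G W l + 1 := by
  by_contra! hlt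
  have hdeg : ∀ z ∈ W, z ≠ l → ¬G.Adj l z → #W ≤ dg G W l + dg G W z := fun z hz hne hadj =>
    hW.ore l hl z hz hne.symm hadj
  obtain ⟨z, hz, hzl, hadj⟩ : ∃ z ∈ W, z ≠ l ∧ ¬G.Adj l z := by
    by_contra! hc
    have h1 : #(W.erase l) ≤ dg G (W.erase l) l := card_le_dg fun w hw =>
      hc w (Finset.mem_of_mem_erase hw) (Finset.ne_of_mem_erase hw)
    have h2 := dg_mono (G := G) (Finset.erase_subset l W) l
    rw [Finset.card_erase_of_mem hl] at h1
    have := hW.four_le l hl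
    omega
  have h1 := hdeg z hz hzl hadj
  have h2 : dg G W z ≤ dg G W l := by
    refine Finset.card_le_card fun y hy => ?_
    rw [Finset.mem_filter] at hy ⊢
    refine ⟨hy.1, ?_⟩
    by_contra hly
    have h3 := hdeg y hy.1 (fun h => hadj (h ▸ hy.2.symm)) hly
    have h4 := hS.dg_add_dg_le subset_rfl hz hy.1 hy.2
    omega
  omega

theorem OreSet.exists_card_le_two_mul_dg (hW : OreSet G W) (hne : W.Nonempty) :
    ∃ x ∈ W, #W ≤ 2 * dg G W x := by
  by_contra! hc
  obtain ⟨x, hx⟩ := hne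
  obtain ⟨y, hy, hne, hadj⟩ : ∃ y ∈ W, x ≠ y ∧ ¬G.Adj x y := by
    by_contra! hcl
    have h1 : #(W.erase x) ≤ dg G (W.erase x) x := card_le_dg fun w hw =>
      hcl w (Finset.mem_of_mem_erase hw) (Finset.ne_of_mem_erase hw).symm
    have h2 := dg_mono (G := G) (Finset.erase_subset x W) x
    rw [Finset.card_erase_of_mem hx] at h1
    have := hW.four_le x hx
    have := hc x hx
    omega
  have := hW.ore x hx y hy hne hadj
  have := hc x hx
  have := hc y hy
  omega

theorem Sparse.exists_three_common (hS : Sparse G W) (hW : OreSet G W) (hne : W.Nonempty) :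
    ∃ u₁ ∈ W, ∃ u₂ ∈ W, u₁ ≠ u₂ ∧ ¬G.Adj u₁ u₂ ∧ 3 ≤ dg G {w ∈ W | G.Adj u₁ w} u₂ := by
  obtain ⟨x, hx, hd⟩ := hW.exists_card_le_two_mul_dg hne
  by_contra! hc
  obtain ⟨N, hN⟩ : ∃ N, N = ({w ∈ W | G.Adj x w} : Finset V) := ⟨_, rfl⟩
  have hNcard : #N = dg G W x := by rw [hN, dg]
  have hxN : x ∈ W \ N := by simp [hN, hx]
  have hNW : N ⊆ W := hN ▸ Finset.filter_subset _ _
  have h1 := Finset.card_nsmul_le_sum N (fun z => dg G W z) 4 fun z hz => hW.four_le z (hNW hz)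
  rw [sum_dg_comm, ← Finset.sum_sdiff hNW, ← Finset.add_sum_erase _ _ hxN, smul_eq_mul] at h1
  have h2 : ∑ y ∈ N, dg G N y ≤ #N • 1 := by
    refine Finset.sum_le_card_nsmul _ _ _ fun y hy => Finset.card_le_one.2 fun c hc d hd => ?_
    rw [hN] at hy hc hd
    simp only [Finset.mem_filter] at hy hc hd
    exact hS x hx y hy.1 hy.2 c hc.1.1 d hd.1.1 hc.1.2 hc.2 hd.1.2 hd.2
  have h3 : ∑ y ∈ (W \ N).erase x, dg G N y ≤ #((W \ N).erase x) • 2 := by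
    refine Finset.sum_le_card_nsmul _ _ _ fun y hy => Nat.le_of_lt_succ ?_
    simp only [hN, Finset.mem_erase, Finset.mem_sdiff, Finset.mem_filter] at hy
    rw [hN]
    exact hc x hx y hy.2.1 hy.1.symm fun h => hy.2.2 ⟨hy.2.1, h⟩
  have h4 := dg_le_card (G := G) N x
  rw [Finset.card_erase_of_mem hxN, Finset.card_sdiff_of_subset hNW, smul_eq_mul] at h3
  rw [smul_eq_mul] at h2
  have := Finset.card_le_card hNW
  have := Finset.card_pos.2 hne
  omega

variable [Fintype V]

namespace Minimal

theorem dg_eq_one_of_book (hM : Minimal G W) {v x u₁ u₂ : V} (hu : G.Adj u₁ u₂) (h₁ : G.Adj u₁ v)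
    (h₂ : G.Adj u₂ v) (hx₁ : G.Adj u₁ x) (hx₂ : G.Adj u₂ x) (hvx : v ≠ x) (hv : v ∈ W)
    (hx : x ∈ W) (hu₁ : u₁ ∈ W) (hu₂ : u₂ ∈ W) :
    G.Adj v x ∧ (∃ z ∈ W, z ∉ ({v, u₁, u₂, x} : Finset V)) ∧
      ∀ z ∈ W, z ∉ ({v, u₁, u₂, x} : Finset V) → dg G {u₁, u₂, x} z = 1 := by
  obtain ⟨H, Q, hB, hsub⟩ := exists_book hu h₁ h₂ hx₁ hx₂ hvx hv hx hu₁ hu₂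
  have hH := hB.card_left_eq_three hM
  have hHe : {u₁, u₂, x} = H := Finset.eq_of_subset_of_card_le hsub (by
    rw [hH, Finset.card_eq_three.2 ⟨u₁, u₂, x, hu.ne, hx₁.ne, hx₂.ne, rfl⟩])
  obtain ⟨ht₁, ht₂⟩ := hB.tight hM
  refine ⟨adj_of_card_le_dg (A := H) (by simp [← hHe]) (by omega), ?_, fun z hz hzK => ?_⟩
  · obtain ⟨z, hz⟩ := hB.nonempty_right hM
    refine ⟨z, hB.subset_right hz, ?_⟩
    rw [hHe, Finset.mem_insert, not_or]
    exact ⟨hB.ne_center hz, fun h => hB.ne h hz rfl⟩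
  · rw [hHe] at hzK ⊢
    rw [← hB.union, ← Finset.insert_union, Finset.mem_union] at hz
    exact ht₂ z (hz.resolve_left hzK)

theorem sparse (hM : Minimal G W) : Sparse G W := by
  intro a ha b hb hab c hc d hd hac hbc had hbd
  by_contra hcd
  obtain ⟨hcd', ⟨z, hz, hzK⟩, h₁⟩ := hM.dg_eq_one_of_book hab hac hbc had hbd hcd hc hd ha hb
  have h₂ := (hM.dg_eq_one_of_book hab had hbd hac hbc (Ne.symm hcd) hd hc ha hb).2.2 z hz
    (by simpa [or_comm, or_left_comm, and_comm, and_left_comm] using hzK)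
  have h₃ := (hM.dg_eq_one_of_book hac hab hbc.symm had hcd' hbd.ne hb hd ha hc).2.2 z hz
    (by simpa [or_comm, or_left_comm, and_comm, and_left_comm] using hzK)
  have h₄ := (hM.dg_eq_one_of_book hbc hab.symm hac.symm hbd hcd' had.ne ha hd hb hc).2.2 z hz
    (by simpa [or_comm, or_left_comm, and_comm, and_left_comm] using hzK)
  replace h₁ := h₁ z hz hzK
  have n₁ := hab.ne
  have n₂ := hac.ne
  have n₃ := had.ne
  have n₄ := hbc.ne
  have n₅ := hbd.ne
  rw [dg_insert (by simp [*]), dg_insert (by simp [*]), dg_singleton] at h₁ h₂ h₃ h₄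
  split_ifs at h₁ h₂ h₃ h₄ <;> omega

end Minimal

end ZThreeConnectivity

namespace ZThreeConnectivity

variable {V : Type} {G : SimpleGraph V} [DecidableEq V] [DecidableRel G.Adj] {W : Finset V}

/-- `v, w, x` are common neighbours of the nonadjacent vertices `u₁, u₂`, all in `W`. -/
structure CommonNeighbours (G : SimpleGraph V) (W : Finset V) (u₁ u₂ v w x : V) : Prop where
  mem_left : u₁ ∈ W
  mem_right : u₂ ∈ W
  mem₁ : v ∈ W
  mem₂ : w ∈ W
  mem₃ : x ∈ W
  ne : u₁ ≠ u₂
  not_adj : ¬G.Adj u₁ u₂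
  ne₁₂ : v ≠ w
  ne₁₃ : v ≠ x
  ne₂₃ : w ≠ x
  left₁ : G.Adj u₁ v
  left₂ : G.Adj u₁ w
  left₃ : G.Adj u₁ x
  right₁ : G.Adj u₂ v
  right₂ : G.Adj u₂ w
  right₃ : G.Adj u₂ x

theorem Sparse.exists_commonNeighbours (hS : Sparse G W) (hW : OreSet G W) (hne : W.Nonempty) :
    ∃ u₁ u₂ v w x, CommonNeighbours G W u₁ u₂ v w x := by
  obtain ⟨u₁, hu₁, u₂, hu₂, hne, hadj, h⟩ := hS.exists_three_common hW hne
  obtain ⟨v, hv, w, hw, x, hx, hvw, hvx, hwx⟩ := Finset.two_lt_card.1 h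
  simp only [Finset.mem_filter] at hv hw hx
  exact ⟨u₁, u₂, v, w, x, hu₁, hu₂, hv.1.1, hw.1.1, hx.1.1, hne, hadj, hvw, hvx, hwx, hv.1.2,
    hw.1.2, hx.1.2, hv.2, hw.2, hx.2⟩

/-- A closed set around `u₁, u₂, x` avoiding `v, w` has at least five vertices. -/
theorem CommonNeighbours.five_le_card {u₁ u₂ v w x : V} (hC : CommonNeighbours G W u₁ u₂ v w x)
    (hS : Sparse G W) (hW : OreSet G W) {H Q : Finset V} (hsub : {u₁, u₂, x} ⊆ H)
    (hdisj : Disjoint H Q) (hvw : v ∉ H ∪ Q ∧ w ∉ H ∪ Q)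
    (hun : insert v (insert w (H ∪ Q)) = W) (hone : ∀ z ∈ Q, dg G H z ≤ 1) : 5 ≤ #H := by
  obtain ⟨m₁, m₂, mv, mw, mx, hne, hadj, nvw, nvx, nwx, l₁, l₂, l₃, r₁, r₂, r₃⟩ := hC
  have hvw' : ¬G.Adj v w :=
    hS.not_adj_of_common mv mw m₁ m₂ hne l₁.symm l₂.symm r₁.symm r₂.symm
  have hvx : ¬G.Adj v x :=
    hS.not_adj_of_common mv mx m₁ m₂ hne l₁.symm l₃.symm r₁.symm r₃.symm
  have hwx : ¬G.Adj w x :=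
    hS.not_adj_of_common mw mx m₁ m₂ hne l₂.symm l₃.symm r₂.symm r₃.symm
  have hcard : #W = #H + #Q + 2 := by
    rw [← hun, Finset.card_insert_of_notMem (by simp_all), Finset.card_insert_of_notMem hvw.2,
      Finset.card_union_of_disjoint hdisj]
  have hsum : ∑ u ∈ H, dg G W u ≤ ∑ u ∈ H, dg G H u + dg G H v + dg G H w + #Q := by
    rw [sum_dg_comm, ← hun, Finset.sum_insert (by simp_all), Finset.sum_insert hvw.2,
      Finset.sum_union hdisj]
    have h : ∑ z ∈ Q, dg G H z ≤ #Q • 1 := Finset.sum_le_card_nsmul _ _ _ hone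
    rw [smul_eq_mul] at h
    omega
  have hore := hW.ore u₁ m₁ u₂ m₂ hne hadj
  have hx4 := hW.four_le x mx
  have hHW : H ⊆ W := hun ▸ Finset.subset_union_left.trans
    ((Finset.subset_insert _ _).trans (Finset.subset_insert _ _))
  have hl₃ := l₃.symm
  have hr₃ := r₃.symm
  have hadj' : ¬G.Adj u₂ u₁ := fun h => hadj h.symm
  have c3 : #({u₁, u₂, x} : Finset V) = 3 :=
    Finset.card_eq_three.2 ⟨u₁, u₂, x, hne, l₃.ne, r₃.ne, rfl⟩
  have ux := l₃.ne
  have ux' := r₃.ne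
  have ddg : ∀ z, dg G {u₁, u₂, x} z = (if G.Adj z x then 1 else 0) +
      (if G.Adj z u₂ then 1 else 0) + if G.Adj z u₁ then 1 else 0 := fun z => by
    rw [dg_insert (by simp [hne, ux]), dg_insert (by simp [ux']), dg_singleton]
  have dsum : ∀ f : V → ℕ, ∑ u ∈ ({u₁, u₂, x} : Finset V), f u = f u₁ + f u₂ + f x := fun f => by
    rw [Finset.sum_insert (by simp [hne, ux]), Finset.sum_pair ux', add_assoc]
  by_contra! hlt
  have hle := Finset.card_le_card hsub
  rcases (show #H = 3 ∨ #H = 4 by omega) with h3 | h4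
  · have hHe : H = {u₁, u₂, x} := (Finset.eq_of_subset_of_card_le hsub (by omega)).symm
    rw [hHe, dsum, dsum] at hsum
    simp only [ddg, SimpleGraph.irrefl, l₁.symm, r₁.symm, l₂.symm, r₂.symm, l₃, r₃, hl₃, hr₃,
      hadj, hadj', hvx, hwx, if_true, if_false] at hsum
    omega
  · obtain ⟨y, hy⟩ : ∃ y, H \ {u₁, u₂, x} = {y} := Finset.card_eq_one.1 (by
      rw [Finset.card_sdiff_of_subset hsub]
      omega)
    have hyH : y ∈ H \ {u₁, u₂, x} := by simp [hy]
    rw [Finset.mem_sdiff] at hyH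
    have hHe : H = insert y {u₁, u₂, x} := by
      rw [Finset.insert_eq, ← hy, Finset.sdiff_union_of_subset hsub]
    have my := hHW hyH.1
    have hyv : y ≠ v := fun h => hvw.1 (Finset.mem_union_left _ (h ▸ hyH.1))
    have hyw : y ≠ w := fun h => hvw.2 (Finset.mem_union_left _ (h ▸ hyH.1))
    have hy4 := hW.four_le y my
    have t₁ : G.Adj y u₁ → G.Adj y u₂ → ¬G.Adj y x := fun h₁ h₂ =>
      hS.not_adj_of_common my mx m₁ m₂ hne h₁ l₃.symm h₂ r₃.symm
    have t₂ : G.Adj y u₁ → G.Adj y u₂ → ¬G.Adj y v := fun h₁ h₂ =>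
      hS.not_adj_of_common my mv m₁ m₂ hne h₁ l₁.symm h₂ r₁.symm
    have t₃ : G.Adj y u₁ → G.Adj y u₂ → ¬G.Adj y w := fun h₁ h₂ =>
      hS.not_adj_of_common my mw m₁ m₂ hne h₁ l₂.symm h₂ r₂.symm
    have t₄ : G.Adj y x → G.Adj y v → ¬G.Adj y u₁ := fun h₁ h₂ =>
      hS.not_adj_of_common my m₁ mx mv nvx.symm h₁ l₃ h₂ l₁
    have t₅ : G.Adj y x → G.Adj y v → ¬G.Adj y u₂ := fun h₁ h₂ =>
      hS.not_adj_of_common my m₂ mx mv nvx.symm h₁ r₃ h₂ r₁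
    have t₆ : G.Adj y x → G.Adj y w → ¬G.Adj y u₁ := fun h₁ h₂ =>
      hS.not_adj_of_common my m₁ mx mw nwx.symm h₁ l₃ h₂ l₂
    have t₇ : G.Adj y x → G.Adj y w → ¬G.Adj y u₂ := fun h₁ h₂ =>
      hS.not_adj_of_common my m₂ mx mw nwx.symm h₁ r₃ h₂ r₂
    rw [hHe, Finset.sum_insert hyH.2, Finset.sum_insert hyH.2, dsum, dsum] at hsum
    simp only [dg_insert hyH.2, ddg, SimpleGraph.irrefl, l₁.symm, r₁.symm, l₂.symm, r₂.symm, l₃,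
      r₃, hl₃, hr₃, hadj, hadj', hvx, hwx, if_true, if_false, G.adj_comm _ y] at hsum
    by_cases a₁ : G.Adj y u₁ <;> by_cases a₂ : G.Adj y u₂ <;> by_cases a₃ : G.Adj y x <;>
      simp only [a₁, a₂, a₃, if_true, if_false, true_imp_iff, not_true_eq_false,
        imp_false] at hsum t₁ t₂ t₃ t₄ t₅ t₆ t₇ <;>
      split_ifs at hsum <;> omega

variable [Fintype V]

theorem CommonNeighbours.false {u₁ u₂ v w x : V} (hC : CommonNeighbours G W u₁ u₂ v w x)
    (hM : Minimal G W) : False := by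
  have hS := hM.sparse
  have hW := hM.oreSet
  have five := fun H Q => hC.five_le_card hS hW (H := H) (Q := Q)
  obtain ⟨m₁, m₂, mv, mw, mx, hne, hadj, nvw, nvx, nwx, l₁, l₂, l₃, r₁, r₂, r₃⟩ := hC
  have hvw : ¬G.Adj v w :=
    hS.not_adj_of_common mv mw m₁ m₂ hne l₁.symm l₂.symm r₁.symm r₂.symm
  have hE : ∀ a b, (pathGraph u₁ v u₂ ⊔ pathGraph u₁ w u₂).Adj a b ↔
      (a = v ∧ (b = u₁ ∨ b = u₂) ∨ b = v ∧ (a = u₁ ∨ a = u₂)) ∨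
        (a = w ∧ (b = u₁ ∨ b = u₂) ∨ b = w ∧ (a = u₁ ∨ a = u₂)) := fun a b => by
    rw [SimpleGraph.sup_adj, pathGraph_adj l₁.ne r₁.ne, pathGraph_adj l₂.ne r₂.ne]
  have e₁ := l₁.ne
  have e₂ := l₂.ne
  have e₃ := r₁.ne
  have e₄ := r₂.ne
  obtain ⟨H, hH, hHW, hc, hone⟩ := exists_dg_le_one
    (contractible_fourCycle (G := G) hne l₁.ne r₁.ne l₂.ne r₂.ne nvw)
    (W := (W.erase v).erase w) (by
      intro z hz
      simp only [Finset.mem_insert, Finset.mem_singleton] at hz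
      rcases hz with rfl | rfl <;> simp [*])
    (fun a ha b hb h => by
      rw [hE] at h
      simp only [Finset.mem_erase] at ha hb
      tauto)
  have n₁ : u₁ ∈ H := hH (by simp)
  have n₂ : u₂ ∈ H := hH (by simp)
  have hxH : x ∈ H := by
    by_contra hxH
    exact hne (eq_of_dg_le_one (hone x (by simp [mx, nvx.symm, nwx.symm]) hxH) n₁ n₂ l₃.symm
      r₃.symm)
  have hvH : v ∉ H := fun h => by simpa using hHW h
  have hwH : w ∉ H := fun h => by simpa using hHW h
  obtain ⟨Q, hQ⟩ : ∃ Q, Q = ((W.erase v).erase w) \ H := ⟨_, rfl⟩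
  have hHQ : H ∪ Q = (W.erase v).erase w := by rw [hQ, Finset.union_sdiff_of_subset hHW]
  have hdisj : Disjoint H Q := hQ ▸ Finset.disjoint_sdiff
  have hun : insert v (insert w (H ∪ Q)) = W := by
    rw [hHQ, Finset.insert_erase (by simp [mw, nvw.symm]), Finset.insert_erase mv]
  have hone' : ∀ z ∈ Q, dg G H z ≤ 1 := fun z hz => by
    rw [hQ, Finset.mem_sdiff] at hz
    exact hone z hz.1 hz.2
  have h5 : 5 ≤ #H := by
    refine five H Q (fun z hz => ?_) hdisj (by simp [hHQ]) hun hone'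
    simp only [Finset.mem_insert, Finset.mem_singleton] at hz
    rcases hz with rfl | rfl | rfl <;> assumption
  rcases Q.eq_empty_or_nonempty with hQe | ⟨z, hz⟩
  · rw [hQe, Finset.union_empty] at hun
    have hv4 := hW.four_le v mv
    have hw4 := hW.four_le w mw
    rw [← hun, dg_insert_self, dg_insert_of_not_adj hwH hvw] at hv4
    rw [← hun, Finset.insert_comm, dg_insert_self] at hw4
    have k₁ := hc.absorb_of_four_le_dg (v := v) (u₁ := u₁) (u₂ := u₂) hvH hv4 fun a ha => by
      rw [hE] at ha
      grind
    have k₂ := k₁.absorb_of_four_le_dg (v := w) (u₁ := u₁) (u₂ := u₂)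
      (by simp [hwH, nvw.symm]) hw4 fun a ha => by
        rw [hE] at ha
        grind
    rw [Finset.insert_comm, hun] at k₂
    exact hM.not_contractible (k₂.of_le (sup_le (pathGraph_le_inside l₁ r₁ m₁ mv m₂)
      (pathGraph_le_inside l₂ r₂ m₁ mw m₂)))
  · have hRW : W \ H ⊆ W := Finset.sdiff_subset
    have hHW' : H ⊆ W := hHW.trans ((Finset.erase_subset _ _).trans (Finset.erase_subset _ _))
    have hmem : ∀ y ∈ Q, y ∈ W := fun y hy => by
      rw [← hun]
      simp [hy]
    have hdeg : ∀ y ∈ Q, dg G W y ≤ dg G (W \ H) y + 1 := fun y hy => by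
      have := dg_sdiff (G := G) hHW' y
      have := hone' y hy
      omega
    obtain ⟨y, hy, hzy⟩ : ∃ y ∈ Q, G.Adj z y := by
      refine dg_pos_iff.1 ?_
      have h1 := hW.four_le z (hmem z hz)
      have h2 := hone' z hz
      have h3 := dg_insert_le (G := G) (insert w (H ∪ Q)) v z
      have h4 := dg_insert_le (G := G) (H ∪ Q) w z
      rw [hun] at h3
      rw [dg_union hdisj] at h4
      omega
    have h1 := hS.dg_add_dg_le hRW (hmem z hz) (hmem y hy) hzy
    have h2 := hS.card_le_two_mul_dg hW (hmem z hz)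
    have h3 := hS.card_le_two_mul_dg hW (hmem y hy)
    have h4 := hdeg z hz
    have h6 := hdeg y hy
    rw [Finset.card_sdiff_of_subset hHW'] at h1
    have := Finset.card_le_card hHW'
    omega

theorem OreSet.contractible (W : Finset V) (hW : OreSet G W) : Contractible G ⊥ W := by
  induction W using Finset.strongInduction with
  | H W ih =>
    by_contra hc
    have hM : Minimal G W := ⟨hW, ih, hc⟩
    obtain ⟨u₁, u₂, v, w, x, hC⟩ := hM.sparse.exists_commonNeighbours hW hM.nonempty
    exact hC.false hM

end ZThreeConnectivity

theorem stmt_15 {V : Type} [Fintype V] (G : SimpleGraph V) [DecidableRel G.Adj]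
    (hdeg : ∀ v : V, 4 ≤ G.degree v)
    (hore : ∀ u v : V, u ≠ v → ¬ G.Adj u v →
      Fintype.card V ≤ G.degree u + G.degree v) :
    G.AConnected (ZMod 3) := by
  classical
  have hdg : ∀ v, ZThreeConnectivity.dg G univ v = G.degree v := fun v => by
    rw [ZThreeConnectivity.dg, ← SimpleGraph.card_neighborFinset_eq_degree,
      SimpleGraph.neighborFinset_eq_filter]
  have h : ZThreeConnectivity.Contractible G ⊥ univ :=
    ZThreeConnectivity.OreSet.contractible univ
      ⟨fun v _ => (hdeg v).trans_eq (hdg v).symm, fun u _ v _ huv hadj => by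
        rw [hdg, hdg]
        exact hore u v huv hadj⟩
  have hG : ⊥ ⊔ ZThreeConnectivity.inside G univ = G := by
    ext u v
    simp [ZThreeConnectivity.inside]
  unfold ZThreeConnectivity.Contractible at h
  rw [hG] at h
  exact fun b hb => h b (by simp) hb
end
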